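/- For every dimension n, every b ≥ 1 and every Λ₀ > 0 there exists a constant C > 0 with the following property. Let Ω ⊂ ℝⁿ be a bounded convex open domain containing 0, let w ∈ C²(Ω) ∩ C(Ω̄) be a convex function with det D²w = 1 in Ω and w constant on ∂Ω, suppose 0 is a balanced point of Ω with constant b, and suppose the operator norm of the Hessian D²w(0) is at most Λ₀. Then Ω has a good shape with constant C: there exist a point y₀ ∈ ℝⁿ and radii 0 < r ≤ R with B_r(y₀) ⊆ Ω ⊆ B_R(y₀) and R/r ≤ C. -/

import Mathlib

open Set Metric RealInnerProductSpace

noncomputable section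

/-- `x` is a balanced point of `F` with constant `b ≥ 1`: for every `y ∈ ∂F` there is
`t ∈ [1/b, b]` with `x - t • (y - x) ∈ ∂F`. -/
def IsBalancedPoint {n : ℕ} (F : Set (EuclideanSpace ℝ (Fin n)))
    (x : EuclideanSpace ℝ (Fin n)) (b : ℝ) : Prop :=
  ∀ y ∈ frontier F, ∃ t : ℝ, 1 / b ≤ t ∧ t ≤ b ∧ x - t • (y - x) ∈ frontier F

section LinearAlgebra

lemma OrthonormalBasis.sum_inner_sq {E : Type*} [NormedAddCommGroup E] [InnerProductSpace ℝ E]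
    {n : ℕ} (b : OrthonormalBasis (Fin n) ℝ E) (a : E) :
    ∑ i, ⟪b i, a⟫ ^ 2 = ‖a‖ ^ 2 := by
  rw [← b.sum_sq_norm_inner_right a]
  simp

variable {E : Type*} [NormedAddCommGroup E] [InnerProductSpace ℝ E] [FiniteDimensional ℝ E] {n : ℕ}

/-- In an orthonormal eigenbasis, the quadratic form of a symmetric operator is diagonal. -/
lemma LinearMap.IsSymmetric.inner_apply_self_eq_sum {T : E →ₗ[ℝ] E} (hT : T.IsSymmetric)
    (hn : Module.finrank ℝ E = n) (a : E) :
    ⟪T a, a⟫ = ∑ i, hT.eigenvalues hn i * ⟪hT.eigenvectorBasis hn i, a⟫ ^ 2 := by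
  rw [← (hT.eigenvectorBasis hn).sum_inner_mul_inner]
  refine Finset.sum_congr rfl fun i _ => ?_
  rw [hT, hT.apply_eigenvectorBasis, inner_smul_right, real_inner_comm a]
  simp only [RCLike.ofReal_real_eq_id, id_eq]
  ring

lemma LinearMap.IsSymmetric.eigenvalues_eq_inner {T : E →ₗ[ℝ] E} (hT : T.IsSymmetric)
    (hn : Module.finrank ℝ E = n) (i : Fin n) :
    hT.eigenvalues hn i =
      ⟪T (hT.eigenvectorBasis hn i), hT.eigenvectorBasis hn i⟫ := by
  rw [hT.apply_eigenvectorBasis, inner_smul_left]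
  simp

lemma LinearMap.IsSymmetric.prod_eigenvalues {T : E →ₗ[ℝ] E} (hT : T.IsSymmetric)
    (hn : Module.finrank ℝ E = n) (hdet : LinearMap.det T = 1) :
    ∏ i, hT.eigenvalues hn i = 1 := by
  have := hT.det_eq_prod_eigenvalues hn
  rw [hdet] at this
  simpa using this.symm

/-- A lower bound on a symmetric operator of determinant one from an upper bound. -/
lemma norm_sq_le_of_det_eq_one {T : E →ₗ[ℝ] E} (hT : T.IsSymmetric)
    (hn : Module.finrank ℝ E = n) (hdet : LinearMap.det T = 1) {L : ℝ}
    (h0 : ∀ a, 0 ≤ ⟪T a, a⟫) (hL : ∀ a, ⟪T a, a⟫ ≤ L * ‖a‖ ^ 2) (a : E) :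
    ‖a‖ ^ 2 ≤ L ^ (n - 1) * ⟪T a, a⟫ := by
  rw [hT.inner_apply_self_eq_sum hn, ← (hT.eigenvectorBasis hn).sum_inner_sq, Finset.mul_sum]
  refine Finset.sum_le_sum fun i _ => ?_
  have hpos : ∀ j, 0 ≤ hT.eigenvalues hn j := fun j => by
    rw [hT.eigenvalues_eq_inner]; exact h0 _
  have hle : ∀ j, hT.eigenvalues hn j ≤ L := fun j => by
    rw [hT.eigenvalues_eq_inner]
    simpa using hL (hT.eigenvectorBasis hn j)
  have h1 : 1 ≤ L ^ (n - 1) * hT.eigenvalues hn i := by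
    rw [← hT.prod_eigenvalues hn hdet, ← Finset.prod_erase_mul _ _ (Finset.mem_univ i)]
    refine mul_le_mul_of_nonneg_right ?_ (hpos i)
    calc _ ≤ ∏ j ∈ Finset.univ.erase i, L :=
          Finset.prod_le_prod (fun j _ => hpos j) (fun j _ => hle j)
      _ = _ := by simp
  nlinarith [sq_nonneg ⟪hT.eigenvectorBasis hn i, a⟫]

/-- An upper bound on a symmetric operator of determinant one from a lower bound. -/
lemma le_norm_sq_of_det_eq_one {T : E →ₗ[ℝ] E} (hT : T.IsSymmetric)
    (hn : Module.finrank ℝ E = n) (hdet : LinearMap.det T = 1) {s : ℝ} (hs : 0 ≤ s)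
    (hL : ∀ a, s * ‖a‖ ^ 2 ≤ ⟪T a, a⟫) (a : E) :
    s ^ (n - 1) * ⟪T a, a⟫ ≤ ‖a‖ ^ 2 := by
  rw [hT.inner_apply_self_eq_sum hn, ← (hT.eigenvectorBasis hn).sum_inner_sq, Finset.mul_sum]
  refine Finset.sum_le_sum fun i _ => ?_
  have hle : ∀ j, s ≤ hT.eigenvalues hn j := fun j => by
    rw [hT.eigenvalues_eq_inner]
    simpa using hL (hT.eigenvectorBasis hn j)
  have h1 : s ^ (n - 1) * hT.eigenvalues hn i ≤ 1 := by
    rw [← hT.prod_eigenvalues hn hdet, ← Finset.prod_erase_mul _ _ (Finset.mem_univ i)]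
    refine mul_le_mul_of_nonneg_right ?_ (hs.trans (hle i))
    calc _ = ∏ j ∈ Finset.univ.erase i, s := by simp
      _ ≤ _ := Finset.prod_le_prod (fun j _ => hs) (fun j _ => hle j)
  nlinarith [sq_nonneg ⟪hT.eigenvectorBasis hn i, a⟫]

lemma log_le_sub_sq {x : ℝ} (h1 : 999 / 1000 ≤ x) (h2 : x ≤ 1001 / 1000) :
    Real.log x ≤ (x - 1) - 49 / 100 * (x - 1) ^ 2 := by
  have h := Real.abs_log_sub_add_sum_range_le (x := 1 - x)
    (by rw [abs_lt]; constructor <;> linarith) 2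
  have h3 : |1 - x| ≤ 1 / 1000 := by rw [abs_le]; constructor <;> linarith
  simp only [Finset.sum_range_succ, Finset.sum_range_zero] at h
  norm_num at h
  have h4 : |1 - x| ^ 3 / (1 - |1 - x|) ≤ (x - 1) ^ 2 * (1 / 100) := by
    rw [div_le_iff₀ (by linarith)]
    have : |1 - x| ^ 3 = |1 - x| * (x - 1) ^ 2 := by
      rw [pow_succ, sq_abs]; ring
    rw [this]
    nlinarith [sq_nonneg (x - 1)]
  have := (abs_le.1 (h.trans h4)).2
  linarith

/-- Quantitative concavity of `log det` near the identity. -/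
lemma sum_sq_le_trace_sub {T : E →ₗ[ℝ] E} (hT : T.IsSymmetric)
    (hn : Module.finrank ℝ E = n) (hdet : LinearMap.det T = 1)
    (h1 : ∀ a, 999 / 1000 * ‖a‖ ^ 2 ≤ ⟪T a, a⟫) (h2 : ∀ a, ⟪T a, a⟫ ≤ 1001 / 1000 * ‖a‖ ^ 2)
    (o : OrthonormalBasis (Fin n) ℝ E) :
    49 / 100 * ∑ i, ‖T (o i) - o i‖ ^ 2 ≤ ∑ i, (⟪T (o i), o i⟫ - 1) := by
  set b := hT.eigenvectorBasis hn with hb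
  have hl1 : ∀ j, 999 / 1000 ≤ hT.eigenvalues hn j := fun j => by
    rw [hT.eigenvalues_eq_inner]
    simpa using h1 (hT.eigenvectorBasis hn j)
  have hl2 : ∀ j, hT.eigenvalues hn j ≤ 1001 / 1000 := fun j => by
    rw [hT.eigenvalues_eq_inner]
    simpa using h2 (hT.eigenvectorBasis hn j)
  set R : E →ₗ[ℝ] E := T - LinearMap.id with hR
  have hRs : R.IsSymmetric := hT.sub LinearMap.IsSymmetric.id
  have tr1 : ∀ c : OrthonormalBasis (Fin n) ℝ E,
      ∑ i, (⟪T (c i), c i⟫ - 1) = LinearMap.trace ℝ E R := fun c => by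
    rw [LinearMap.trace_eq_sum_inner R c]
    refine Finset.sum_congr rfl fun i _ => ?_
    simp [hR, inner_sub_right, real_inner_comm]
  have tr2 : ∀ c : OrthonormalBasis (Fin n) ℝ E,
      ∑ i, ‖T (c i) - c i‖ ^ 2 = LinearMap.trace ℝ E (R ∘ₗ R) := fun c => by
    rw [LinearMap.trace_eq_sum_inner _ c]
    refine Finset.sum_congr rfl fun i _ => ?_
    rw [LinearMap.comp_apply, ← hRs, real_inner_self_eq_norm_sq]
    simp [hR]
  rw [tr1 o, tr2 o, ← tr1 b, ← tr2 b, Finset.mul_sum]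
  have hlog : ∑ i, Real.log (hT.eigenvalues hn i) = 0 := by
    rw [← Real.log_prod (fun i _ => by linarith [hl1 i]), hT.prod_eigenvalues hn hdet, Real.log_one]
  have : ∀ i, Real.log (hT.eigenvalues hn i) ≤ (⟪T (b i), b i⟫ - 1) -
      49 / 100 * ‖T (b i) - b i‖ ^ 2 := fun i => by
    have e1 : T (b i) - b i = (hT.eigenvalues hn i - 1) • b i := by
      rw [hb, hT.apply_eigenvectorBasis, sub_smul]; simp
    rw [e1, norm_smul, mul_pow, ← hT.eigenvalues_eq_inner]
    simpa using log_le_sub_sq (hl1 i) (hl2 i)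
  have h3 := Finset.sum_le_sum fun i (_ : i ∈ Finset.univ) => this i
  rw [hlog, Finset.sum_sub_distrib] at h3
  linarith

/-- A positive definite symmetric operator has a symmetric inverse square root. -/
lemma exists_symmetric_inv_sqrt {X : E →ₗ[ℝ] E} (hX : X.IsSymmetric)
    (hpos : ∀ a, a ≠ 0 → 0 < ⟪X a, a⟫) :
    ∃ P : E →ₗ[ℝ] E, P.IsSymmetric ∧ P ∘ₗ X ∘ₗ P = LinearMap.id := by
  set b := hX.eigenvectorBasis rfl with hb
  set l := hX.eigenvalues rfl with hl
  have hlpos : ∀ i, 0 < l i := fun i => by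
    rw [hl, hX.eigenvalues_eq_inner]
    exact hpos _ ((hX.eigenvectorBasis rfl).orthonormal.ne_zero i)
  set P : E →ₗ[ℝ] E := ∑ i, (√(l i))⁻¹ • (innerₛₗ ℝ (b i)).smulRight (b i) with hP
  have hPa : ∀ a, P a = ∑ i, (√(l i))⁻¹ • (⟪b i, a⟫ • b i) := fun a => by
    simp [hP, LinearMap.sum_apply]
  have hPb : ∀ j, P (b j) = (√(l j))⁻¹ • b j := fun j => by
    rw [hPa, Finset.sum_eq_single j]
    · simp
    · intro i _ hij
      rw [b.orthonormal.2 hij]; simp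
    · simp
  refine ⟨P, fun x y => ?_, ?_⟩
  · rw [hPa, hPa, sum_inner, inner_sum]
    refine Finset.sum_congr rfl fun i _ => ?_
    simp only [inner_smul_left, inner_smul_right, RCLike.conj_to_real, real_inner_comm x]
    ring
  · refine b.toBasis.ext fun j => ?_
    have hXb : X (b j) = l j • b j := by
      rw [hb, hX.apply_eigenvectorBasis]; simp [hl]
    have h0 : √(l j) ≠ 0 := (Real.sqrt_pos.2 (hlpos j)).ne'
    simp only [OrthonormalBasis.coe_toBasis, LinearMap.comp_apply, LinearMap.id_apply, hPb,
      map_smul, hXb, smul_smul]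
    rw [show (√(l j))⁻¹ * l j * (√(l j))⁻¹ = 1 by
      nth_rewrite 2 [← Real.mul_self_sqrt (hlpos j).le]; field_simp, one_smul]

/-- The off-diagonal part of the quantitative concavity of `log det`, for two perturbations
of the identity. -/
lemma sum_off_diag_sq_le {Y Z : E →ₗ[ℝ] E} (hY : Y.IsSymmetric) (hZ : Z.IsSymmetric)
    (hn : Module.finrank ℝ E = n) (hYd : LinearMap.det Y = 1) (hZd : LinearMap.det Z = 1)
    (hY1 : ∀ a, 999 / 1000 * ‖a‖ ^ 2 ≤ ⟪Y a, a⟫) (hY2 : ∀ a, ⟪Y a, a⟫ ≤ 1001 / 1000 * ‖a‖ ^ 2)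
    (hZ1 : ∀ a, 999 / 1000 * ‖a‖ ^ 2 ≤ ⟪Z a, a⟫) (hZ2 : ∀ a, ⟪Z a, a⟫ ≤ 1001 / 1000 * ‖a‖ ^ 2)
    (o : OrthonormalBasis (Fin n) ℝ E) (k : Fin n) :
    49 / 100 * ∑ i ∈ Finset.univ.erase k, ⟪(Y - Z) (o i), o k⟫ ^ 2 ≤
      ∑ i, ((⟪Y (o i), o i⟫ - 1) + (⟪Z (o i), o i⟫ - 1)) := by
  have h1 := sum_sq_le_trace_sub hY hn hYd hY1 hY2 o
  have h2 := sum_sq_le_trace_sub hZ hn hZd hZ1 hZ2 o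
  have hD : (Y - Z).IsSymmetric := hY.sub hZ
  have h3 : ∑ i, ‖(Y - Z) (o i)‖ ^ 2 ≤
      2 * (∑ i, ‖Y (o i) - o i‖ ^ 2 + ∑ i, ‖Z (o i) - o i‖ ^ 2) := by
    rw [← Finset.sum_add_distrib, Finset.mul_sum]
    refine Finset.sum_le_sum fun i _ => ?_
    have e : (Y - Z) (o i) = (Y (o i) - o i) - (Z (o i) - o i) := by
      rw [LinearMap.sub_apply]; abel
    have := parallelogram_law_with_norm ℝ (Y (o i) - o i) (Z (o i) - o i)
    rw [e]
    nlinarith [mul_self_nonneg ‖(Y (o i) - o i) + (Z (o i) - o i)‖]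
  have h4 : 2 * ∑ i ∈ Finset.univ.erase k, ⟪(Y - Z) (o i), o k⟫ ^ 2 ≤
      ∑ i, ‖(Y - Z) (o i)‖ ^ 2 := by
    rw [← Finset.sum_erase_add _ _ (Finset.mem_univ k), two_mul]
    refine add_le_add (Finset.sum_le_sum fun i _ => ?_) ?_
    · have := abs_real_inner_le_norm ((Y - Z) (o i)) (o k)
      rw [o.orthonormal.1 k, mul_one] at this
      rw [← sq_abs]
      gcongr
    · rw [← o.sum_inner_sq]
      refine (Finset.sum_le_univ_sum_of_nonneg fun i => sq_nonneg _).trans_eq ?_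
      refine Finset.sum_congr rfl fun i _ => ?_
      rw [hD]
  rw [Finset.sum_add_distrib]
  linarith

lemma transverse_scalar_ineq {M t m D g κ μ yz q : ℝ} (hM : 0 < M) (hm : 0 < m)
    (hMm : 999 / 1000 * (t ^ 2 * m) ≤ M) (hq : 2 * (999 / 1000) * m ≤ q)
    (hκ : 191 / 100 ≤ κ) (hμ : (1 - μ) ^ 2 ≤ 107 / 100) {c : ℝ}
    (h : (yz + 2 * (-g) * t * (√m * D) + (-g) ^ 2 * t ^ 2 * q) / M - (g + -g * μ) ^ 2
      + κ * (-g) ^ 2 ≤ c) :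
    (yz - 49 / 100 * D ^ 2) / M + g ^ 2 / 2 ≤ c := by
  have hs : √m ^ 2 = m := Real.sq_sqrt hm.le
  have e1 : (t ^ 2 * m) / M ≤ 1000 / 999 := by
    rw [div_le_iff₀ hM]; linarith
  have e0 : 0 ≤ (t ^ 2 * m) / M := by positivity
  have e2 : 2 * (999 / 1000) * ((t ^ 2 * m) / M) * g ^ 2 ≤ (-g) ^ 2 * t ^ 2 * q / M := by
    have : 2 * (999 / 1000) * ((t ^ 2 * m) / M) * g ^ 2 =
        (-g) ^ 2 * t ^ 2 * (2 * (999 / 1000) * m) / M := by ring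
    rw [this]
    exact div_le_div_of_nonneg_right (mul_le_mul_of_nonneg_left hq (by positivity)) hM.le
  have e3 : -(g ^ 2 * (t ^ 2 * m / M) * (100 / 49)) ≤
      49 / 100 * D ^ 2 / M + 2 * (-g) * t * (√m * D) / M := by
    have : 0 ≤ 49 / 100 * (D - 100 / 49 * g * t * √m) ^ 2 / M := by positivity
    have e : 49 / 100 * (D - 100 / 49 * g * t * √m) ^ 2 / M =
      49 / 100 * D ^ 2 / M + 2 * (-g) * t * (√m * D) / M + g ^ 2 * (t ^ 2 * m / M) * (100 / 49) := by
      rw [← hs]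
      simp only [Real.sqrt_sq (Real.sqrt_nonneg m)]
      field_simp
      ring
    linarith
  have e4 : (g + -g * μ) ^ 2 ≤ 107 / 100 * g ^ 2 := by
    nlinarith [sq_nonneg g]
  have e5 : 191 / 100 * g ^ 2 ≤ κ * (-g) ^ 2 := by nlinarith [sq_nonneg g]
  have e6 : (t ^ 2 * m / M) * g ^ 2 ≤ 1000 / 999 * g ^ 2 := by gcongr
  rw [add_div, add_div] at h
  rw [sub_div]
  nlinarith [sq_nonneg g]

lemma mul_sq_le_of_mul_eq_add {β v g a : ℝ} (hβ : 4 ≤ β) (h : β * v = g + a) :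
    β * v ^ 2 ≤ g ^ 2 / 2 + 2 * a ^ 2 := by
  have e2 : 4 * (β * v ^ 2) ≤ (g + a) ^ 2 := by
    rw [← h]; nlinarith [mul_nonneg (by linarith : 0 ≤ β) (sq_nonneg v)]
  nlinarith [sq_nonneg (g - a), sq_nonneg a]

lemma sub_sq_le (a b : ℝ) : (a - b) ^ 2 ≤ 2 * a ^ 2 + 2 * b ^ 2 := by
  nlinarith [sq_nonneg (a + b)]

set_option maxHeartbeats 1600000 in
/-- The algebraic core of the interior second derivative estimate: the consequence of the second
order conditions at a maximum point of the auxiliary function. -/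
lemma trace_bound_of_second_order {X Y Z : E →ₗ[ℝ] E} (hX : X.IsSymmetric) (hY : Y.IsSymmetric)
    (hZ : Z.IsSymmetric) (hn : Module.finrank ℝ E = n) (hXd : LinearMap.det X = 1)
    (hYd : LinearMap.det Y = 1) (hZd : LinearMap.det Z = 1)
    (hpos : ∀ a, a ≠ 0 → 0 < ⟪X a, a⟫)
    (hY1 : ∀ a, 999 / 1000 * ⟪X a, a⟫ ≤ ⟪Y a, a⟫) (hY2 : ∀ a, ⟪Y a, a⟫ ≤ 1001 / 1000 * ⟪X a, a⟫)
    (hZ1 : ∀ a, 999 / 1000 * ⟪X a, a⟫ ≤ ⟪Z a, a⟫) (hZ2 : ∀ a, ⟪Z a, a⟫ ≤ 1001 / 1000 * ⟪X a, a⟫)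
    {e p x : E} (he : ‖e‖ = 1) {M t κ μ u β A R : ℝ} (hM : 0 < M)
    (hMm : 999 / 1000 * (t ^ 2 * ⟪X e, e⟫) ≤ M) (hκ : 191 / 100 ≤ κ)
    (hμ : (1 - μ) ^ 2 ≤ 107 / 100) (hβ : 4 ≤ β) (hR : 0 < R) (hx : ‖x‖ ≤ R)
    (hA : A = 1 / (4 * R ^ 2))
    (H : ∀ (ξ : E) (ν : ℝ), (⟪Y ξ, ξ⟫ + ⟪Z ξ, ξ⟫ - 2 * ⟪X ξ, ξ⟫ + 2 * ν * t * ⟪(Y - Z) ξ, e⟫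
        + ν ^ 2 * t ^ 2 * (⟪Y e, e⟫ + ⟪Z e, e⟫)) / M
        - ((β * ⟪p, ξ⟫ / u - A * ⟪x, ξ⟫) + ν * μ) ^ 2 + κ * ν ^ 2
        ≤ β * ⟪X ξ, ξ⟫ / u + β * (⟪p, ξ⟫ / u) ^ 2 - A * ‖ξ‖ ^ 2) :
    ∃ S : ℝ, 0 ≤ S ∧ ⟪X e, e⟫ ≤ S ^ (n - 1) ∧
      A / 2 * S ≤ β * n / u + (2 * β ^ 2 + β) * (⟪p, e⟫ / u) ^ 2 / ⟪X e, e⟫ := by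
  obtain ⟨P, hP, hPX⟩ := exists_symmetric_inv_sqrt hX hpos
  have hPX' : ∀ a, P (X (P a)) = a := fun a => by
    simpa using LinearMap.congr_fun hPX a
  have e0 : e ≠ 0 := by rintro rfl; simp at he
  set m := ⟪X e, e⟫ with hm
  have hm0 : 0 < m := hpos e e0
  have hPd : LinearMap.det P * LinearMap.det P = 1 := by
    have := congrArg LinearMap.det hPX
    rw [LinearMap.det_comp, LinearMap.det_comp, hXd, LinearMap.det_id] at this
    linarith
  have hconj : ∀ T : E →ₗ[ℝ] E, T.IsSymmetric → (P ∘ₗ T ∘ₗ P).IsSymmetric := fun T hT a b => by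
    simp only [LinearMap.comp_apply]
    rw [hP, hT, hP]
  have hconjd : ∀ T : E →ₗ[ℝ] E, LinearMap.det T = 1 → LinearMap.det (P ∘ₗ T ∘ₗ P) = 1 :=
    fun T hT => by
      rw [LinearMap.det_comp, LinearMap.det_comp, hT]; linarith
  have hXP : ∀ a, ⟪X (P a), P a⟫ = ‖a‖ ^ 2 := fun a => by
    rw [← hP, hPX', real_inner_self_eq_norm_sq]
  have hconjq : ∀ (T : E →ₗ[ℝ] E) (a b : E), ⟪(P ∘ₗ T ∘ₗ P) a, b⟫ = ⟪T (P a), P b⟫ :=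
    fun T a b => by simp only [LinearMap.comp_apply]; rw [hP]
  -- the orthonormal basis adapted to `e`
  set b0 := X (P e) with hb0
  have hPb0 : P b0 = e := hPX' e
  have hb0n : ‖b0‖ ^ 2 = m := by rw [← hXP, hPb0]
  have hsm : 0 < √m := Real.sqrt_pos.2 hm0
  have hb0n' : ‖b0‖ = √m := by rw [← hb0n, Real.sqrt_sq (norm_nonneg _)]
  have hnpos : 0 < n := by
    rw [← hn]
    exact Module.finrank_pos_iff_exists_ne_zero.2 ⟨e, e0⟩
  set k : Fin n := ⟨0, hnpos⟩
  obtain ⟨o, ho⟩ : ∃ o : OrthonormalBasis (Fin n) ℝ E, o k = (√m)⁻¹ • b0 := by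
    have hv : Orthonormal ℝ (({k} : Set (Fin n)).domRestrict fun _ => (√m)⁻¹ • b0) := by
      refine ⟨fun i => ?_, fun i j hij => ?_⟩
      · change ‖(√m)⁻¹ • b0‖ = 1
        rw [norm_smul, norm_inv, hb0n', Real.norm_eq_abs, abs_of_pos hsm]
        exact inv_mul_cancel₀ hsm.ne'
      · exact absurd (Subtype.ext ((i.2 : (i : Fin n) = k).trans (j.2 : (j : Fin n) = k).symm)) hij
    obtain ⟨o, ho⟩ := hv.exists_orthonormalBasis_extension_of_card_eq (by simp [hn])
    exact ⟨o, ho k rfl⟩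
  have hPk : P (o k) = (√m)⁻¹ • e := by rw [ho, map_smul, hPb0]
  have hePk : e = √m • P (o k) := by rw [hPk, smul_smul, mul_inv_cancel₀ hsm.ne', one_smul]
  set S := ∑ i, ‖P (o i)‖ ^ 2 with hS
  have hS0 : 0 ≤ S := Finset.sum_nonneg fun i _ => sq_nonneg _
  have hsumP : ∀ a, ∑ i, ⟪a, P (o i)⟫ ^ 2 = ‖P a‖ ^ 2 := fun a => by
    rw [← o.sum_inner_sq]
    refine Finset.sum_congr rfl fun i _ => ?_
    rw [← hP, real_inner_comm]
  have hPS : ∀ a, ‖P a‖ ^ 2 ≤ S * ‖a‖ ^ 2 := fun a => by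
    rw [← hsumP, hS, Finset.sum_mul]
    refine Finset.sum_le_sum fun i _ => ?_
    rw [← sq_abs, mul_comm, ← mul_pow]
    gcongr
    exact abs_real_inner_le_norm _ _
  refine ⟨S, hS0, ?_, ?_⟩
  · have hPP : (P ∘ₗ P).IsSymmetric := fun a b => by
      simp only [LinearMap.comp_apply]; rw [hP, hP]
    have hq : ∀ a, ⟪(P ∘ₗ P) a, a⟫ = ‖P a‖ ^ 2 := fun a => by
      simp only [LinearMap.comp_apply]; rw [hP, real_inner_self_eq_norm_sq]
    have := norm_sq_le_of_det_eq_one hPP hn (by rw [LinearMap.det_comp]; exact hPd) (L := S)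
      (fun a => by rw [hq]; positivity) (fun a => by rw [hq]; exact hPS a) b0
    rw [hq, hPb0, he, hb0n] at this
    simpa using this
  set g : Fin n → ℝ := fun i => β * ⟪p, P (o i)⟫ / u - A * ⟪x, P (o i)⟫ with hg
  set yz : Fin n → ℝ := fun i => (⟪(P ∘ₗ Y ∘ₗ P) (o i), o i⟫ - 1) +
    (⟪(P ∘ₗ Z ∘ₗ P) (o i), o i⟫ - 1) with hyz
  set c : Fin n → ℝ := fun i => β / u + β * (⟪p, P (o i)⟫ / u) ^ 2 - A * ‖P (o i)‖ ^ 2 with hc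
  have hyz' : ∀ i, ⟪Y (P (o i)), P (o i)⟫ + ⟪Z (P (o i)), P (o i)⟫ - 2 * ⟪X (P (o i)), P (o i)⟫
      = yz i := fun i => by
    rw [hXP, o.orthonormal.1, hyz]
    simp only [hconjq]; ring
  have hi : ∀ i, i ≠ k →
      (yz i - 49 / 100 * ⟪((P ∘ₗ Y ∘ₗ P) - (P ∘ₗ Z ∘ₗ P)) (o i), o k⟫ ^ 2) / M + (g i) ^ 2 / 2
        ≤ c i := fun i _ => by
    refine transverse_scalar_ineq (t := t) (m := m) (κ := κ) (μ := μ)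
      (q := ⟪Y e, e⟫ + ⟪Z e, e⟫) hM hm0 hMm ?_ hκ hμ ?_
    · linarith [hY1 e, hZ1 e]
    · have h1 := H (P (o i)) (-g i)
      rw [hyz', hXP, o.orthonormal.1] at h1
      have h2 : ⟪(Y - Z) (P (o i)), e⟫ =
          √m * ⟪((P ∘ₗ Y ∘ₗ P) - (P ∘ₗ Z ∘ₗ P)) (o i), o k⟫ := by
        conv_lhs => rw [hePk]
        rw [inner_smul_right, LinearMap.sub_apply, LinearMap.sub_apply, inner_sub_left,
          inner_sub_left, hconjq, hconjq]
      rw [h2] at h1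
      simpa [hc, hg] using h1
  have hk : yz k / M - (g k) ^ 2 ≤ c k := by
    have h1 := H (P (o k)) 0
    rw [hyz', hXP, o.orthonormal.1] at h1
    simpa [hc, hg] using h1
  -- absorb the gradient terms
  have hA0 : 0 < A := by rw [hA]; positivity
  have hβ0 : 0 < β := by linarith
  have hi' : ∀ i, i ≠ k →
      (yz i - 49 / 100 * ⟪((P ∘ₗ Y ∘ₗ P) - (P ∘ₗ Z ∘ₗ P)) (o i), o k⟫ ^ 2) / M ≤
        β / u - A * ‖P (o i)‖ ^ 2 + 2 * A ^ 2 * ⟪x, P (o i)⟫ ^ 2 := fun i hik => by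
    have h1 := hi i hik
    have h2 : β * (⟪p, P (o i)⟫ / u) ^ 2 ≤ (g i) ^ 2 / 2 + 2 * A ^ 2 * ⟪x, P (o i)⟫ ^ 2 := by
      have e1 : β * (⟪p, P (o i)⟫ / u) = g i + A * ⟪x, P (o i)⟫ := by
        simp only [hg]; ring
      have := mul_sq_le_of_mul_eq_add hβ e1
      rw [mul_pow] at this
      linarith
    simp only [hc] at h1
    linarith
  have hk' : yz k / M ≤ β / u - A * ‖P (o k)‖ ^ 2 + 2 * A ^ 2 * ⟪x, P (o k)⟫ ^ 2
      + (2 * β ^ 2 + β) * (⟪p, e⟫ / u) ^ 2 / m := by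
    have h2 : (⟪p, P (o k)⟫ / u) ^ 2 = (⟪p, e⟫ / u) ^ 2 / m := by
      rw [hPk, inner_smul_right]
      have := Real.sq_sqrt hm0.le
      rw [mul_div_assoc, mul_pow, inv_pow, this]; ring
    simp only [hc] at hk
    rw [mul_div_assoc (2 * β ^ 2 + β), ← h2]
    have e1 : g k = β * (⟪p, P (o k)⟫ / u) - A * ⟪x, P (o k)⟫ := by
      simp only [hg]; ring
    have e2 := sub_sq_le (β * (⟪p, P (o k)⟫ / u)) (A * ⟪x, P (o k)⟫)
    rw [← e1, mul_pow, mul_pow] at e2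
    linarith
  have hYc := sum_off_diag_sq_le (hconj Y hY) (hconj Z hZ) hn (hconjd Y hYd) (hconjd Z hZd)
    (fun a => by rw [hconjq, ← hXP]; exact hY1 _) (fun a => by rw [hconjq, ← hXP]; exact hY2 _)
    (fun a => by rw [hconjq, ← hXP]; exact hZ1 _) (fun a => by rw [hconjq, ← hXP]; exact hZ2 _) o k
  have hsum := add_le_add (Finset.sum_le_sum fun i (hi : i ∈ Finset.univ.erase k) =>
    hi' i (Finset.ne_of_mem_erase hi)) hk'
  have hl : 0 ≤ ∑ i ∈ Finset.univ.erase k,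
      (yz i - 49 / 100 * ⟪((P ∘ₗ Y ∘ₗ P) - (P ∘ₗ Z ∘ₗ P)) (o i), o k⟫ ^ 2) / M + yz k / M := by
    rw [← Finset.sum_div, ← add_div, Finset.sum_sub_distrib, ← Finset.mul_sum]
    rw [← Finset.sum_erase_add _ _ (Finset.mem_univ k)] at hYc
    refine div_nonneg ?_ hM.le
    linarith
  have hr := Finset.sum_erase_add Finset.univ
    (fun i => β / u - A * ‖P (o i)‖ ^ 2 + 2 * A ^ 2 * ⟪x, P (o i)⟫ ^ 2) (Finset.mem_univ k)
  have hr2 : ∑ i, (β / u - A * ‖P (o i)‖ ^ 2 + 2 * A ^ 2 * ⟪x, P (o i)⟫ ^ 2) =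
      n * (β / u) - A * S + 2 * A ^ 2 * ‖P x‖ ^ 2 := by
    rw [Finset.sum_add_distrib, Finset.sum_sub_distrib, ← Finset.mul_sum, ← Finset.mul_sum,
      hsumP, ← hS, Finset.sum_const, Finset.card_univ, Fintype.card_fin, nsmul_eq_mul]
  have hxS : 2 * A ^ 2 * ‖P x‖ ^ 2 ≤ A / 2 * S := by
    have h1 : ‖P x‖ ^ 2 ≤ S * R ^ 2 := (hPS x).trans (by gcongr)
    have h2 : A * R ^ 2 = 1 / 4 := by rw [hA]; field_simp
    calc 2 * A ^ 2 * ‖P x‖ ^ 2 ≤ 2 * A ^ 2 * (S * R ^ 2) := by gcongr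
      _ = 2 * A * S * (A * R ^ 2) := by ring
      _ = _ := by rw [h2]; ring
  have : (n : ℝ) * (β / u) = β * n / u := by ring
  linarith

end LinearAlgebra

section Jets

/-- `φ` is twice differentiable at `0` with derivatives `p` and `q`. -/
def HasJet (φ : ℝ → ℝ) (p q : ℝ) : Prop :=
  ∃ φ' : ℝ → ℝ, (∀ᶠ s in nhds 0, HasDerivAt φ (φ' s) s) ∧ φ' 0 = p ∧ HasDerivAt φ' q 0

variable {φ ψ : ℝ → ℝ} {p q p₁ q₁ : ℝ}

lemma HasJet.hasDerivAt (h : HasJet φ p q) : HasDerivAt φ p 0 := by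
  obtain ⟨φ', h1, rfl, -⟩ := h
  exact h1.self_of_nhds

lemma HasJet.add (h : HasJet φ p q) (h₁ : HasJet ψ p₁ q₁) :
    HasJet (fun s => φ s + ψ s) (p + p₁) (q + q₁) := by
  obtain ⟨φ', h1, rfl, h3⟩ := h
  obtain ⟨ψ', k1, rfl, k3⟩ := h₁
  refine ⟨fun s => φ' s + ψ' s, ?_, rfl, h3.add k3⟩
  filter_upwards [h1, k1] with s hs ks using hs.add ks

lemma HasJet.const_mul (c : ℝ) (h : HasJet φ p q) : HasJet (fun s => c * φ s) (c * p) (c * q) := by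
  obtain ⟨φ', h1, rfl, h3⟩ := h
  refine ⟨fun s => c * φ' s, ?_, rfl, h3.const_mul c⟩
  filter_upwards [h1] with s hs using hs.const_mul c

lemma HasJet.sub (h : HasJet φ p q) (h₁ : HasJet ψ p₁ q₁) :
    HasJet (fun s => φ s - ψ s) (p - p₁) (q - q₁) := by
  convert h.add (h₁.const_mul (-1)) using 1
  · ext s; ring
  · ring
  · ring

lemma HasJet.log (h : HasJet φ p q) (h0 : φ 0 ≠ 0) :
    HasJet (fun s => Real.log (φ s)) (p / φ 0) (q / φ 0 - (p / φ 0) ^ 2) := by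
  have hd := h.hasDerivAt
  obtain ⟨φ', h1, rfl, h3⟩ := h
  refine ⟨fun s => φ' s / φ s, ?_, rfl, ?_⟩
  · filter_upwards [h1, hd.continuousAt.eventually_ne h0] with s hs hs' using hs.log hs'
  · refine (h3.fun_div hd h0).congr_deriv ?_
    field_simp

lemma hasJet_quadratic (a b c : ℝ) : HasJet (fun s => a + b * s + c * s ^ 2) b (2 * c) := by
  refine ⟨fun s => b + 2 * c * s, Filter.Eventually.of_forall fun s => ?_, by simp, ?_⟩
  · have := (((hasDerivAt_id s).const_mul b).const_add a).add (((hasDerivAt_id s).pow 2).const_mul c)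
    refine this.congr_deriv ?_
    simp; ring
  · simpa using ((hasDerivAt_id (0 : ℝ)).const_mul (2 * c)).const_add b

lemma HasJet.eq_zero_of_isLocalMin (h : HasJet φ p q) (hm : IsLocalMin φ 0) : p = 0 :=
  hm.hasDerivAt_eq_zero h.hasDerivAt

lemma HasJet.nonneg_of_isLocalMin (h : HasJet φ p q) (hm : IsLocalMin φ 0) : 0 ≤ q := by
  by_contra! hq
  have hp := h.eq_zero_of_isLocalMin hm
  have hc := h.hasDerivAt.continuousAt
  obtain ⟨φ', h1, h2, h3⟩ := h
  have hd : deriv φ =ᶠ[nhds 0] φ' := by filter_upwards [h1] with s hs using hs.deriv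
  have hmax : IsLocalMax φ 0 := by
    refine isLocalMax_of_deriv_deriv_neg ?_ ?_ hc
    · rw [hd.deriv_eq, h3.deriv]; exact hq
    · rw [hd.eq_of_nhds, h2, hp]
  have hconst : φ =ᶠ[nhds 0] fun _ => φ 0 := by
    filter_upwards [hm, hmax] with s a b using le_antisymm b a
  have hd0 : φ' =ᶠ[nhds 0] fun _ => 0 := by
    refine hd.symm.trans (hconst.deriv.trans ?_)
    simp
  have := hd0.deriv_eq
  rw [h3.deriv] at this
  simp at this
  linarith

lemma nonneg_of_second_deriv_nonneg {f f' f'' : ℝ → ℝ} {t : ℝ} (ht : 0 ≤ t)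
    (h1 : ∀ s ∈ Icc 0 t, HasDerivAt f (f' s) s) (h2 : ∀ s ∈ Icc 0 t, HasDerivAt f' (f'' s) s)
    (h3 : ∀ s ∈ Icc 0 t, 0 ≤ f'' s) (h0 : f 0 = 0) (h0' : f' 0 = 0) : 0 ≤ f t := by
  have hm' : MonotoneOn f' (Icc 0 t) := by
    refine monotoneOn_of_deriv_nonneg (convex_Icc _ _)
      (fun s hs => (h2 s hs).continuousAt.continuousWithinAt)
      (fun s hs => (h2 s (interior_subset hs)).differentiableAt.differentiableWithinAt)
      fun s hs => ?_
    rw [(h2 s (interior_subset hs)).deriv]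
    exact h3 s (interior_subset hs)
  have hm : MonotoneOn f (Icc 0 t) := by
    refine monotoneOn_of_deriv_nonneg (convex_Icc _ _)
      (fun s hs => (h1 s hs).continuousAt.continuousWithinAt)
      (fun s hs => (h1 s (interior_subset hs)).differentiableAt.differentiableWithinAt)
      fun s hs => ?_
    rw [(h1 s (interior_subset hs)).deriv, ← h0']
    exact hm' (left_mem_Icc.2 ht) (interior_subset hs) (interior_subset hs).1
  rw [← h0]
  exact hm (left_mem_Icc.2 ht) (right_mem_Icc.2 ht) ht

end Jets

section Solutions

variable {E : Type*} [NormedAddCommGroup E] [InnerProductSpace ℝ E] [FiniteDimensional ℝ E] {n : ℕ}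

/-- Convex `C²` solutions of `det D²w = 1` on a bounded convex open set, with zero boundary
values. -/
structure IsMongeAmpereSolution (Ω : Set E) (w : E → ℝ) (Dw : E → E) (D2w : E → (E →L[ℝ] E)) :
    Prop where
  convex : Convex ℝ Ω
  isOpen : IsOpen Ω
  isBounded : Bornology.IsBounded Ω
  continuousOn : ContinuousOn w (closure Ω)
  convexOn : ConvexOn ℝ (closure Ω) w
  hasGradientAt : ∀ x ∈ Ω, HasGradientAt w (Dw x) x
  hasFDerivAt : ∀ x ∈ Ω, HasFDerivAt Dw (D2w x) x
  continuousOn_hess : ContinuousOn D2w Ω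
  det_eq_one : ∀ x ∈ Ω, LinearMap.det (D2w x : E →ₗ[ℝ] E) = 1
  eq_zero : ∀ x ∈ frontier Ω, w x = 0

namespace IsMongeAmpereSolution

variable {Ω : Set E} {w : E → ℝ} {Dw : E → E} {D2w : E → (E →L[ℝ] E)}

lemma isSymmetric (h : IsMongeAmpereSolution Ω w Dw D2w) {x : E} (hx : x ∈ Ω) :
    (D2w x : E →ₗ[ℝ] E).IsSymmetric := by
  intro a b
  have h1 : ∀ᶠ y in nhds x, HasFDerivAt w (InnerProductSpace.toDual ℝ E (Dw y)) y := by
    filter_upwards [h.isOpen.mem_nhds hx] with y hy using (h.hasGradientAt y hy).hasFDerivAt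
  have h2 : HasFDerivAt (fun y => InnerProductSpace.toDual ℝ E (Dw y))
      ((InnerProductSpace.toDual ℝ E).toContinuousLinearEquiv.toContinuousLinearMap.comp
        (D2w x)) x :=
    ((InnerProductSpace.toDual ℝ E).toContinuousLinearEquiv.toContinuousLinearMap.hasFDerivAt).comp
      x (h.hasFDerivAt x hx)
  have := second_derivative_symmetric_of_eventually h1 h2 a b
  simp only [ContinuousLinearMap.comp_apply] at this
  change ⟪D2w x a, b⟫ = ⟪D2w x b, a⟫ at this
  change ⟪D2w x a, b⟫ = ⟪a, D2w x b⟫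
  rw [this, real_inner_comm]

omit [FiniteDimensional ℝ E] in
lemma hasDerivAt_line_aux (x a : E) (s : ℝ) : HasDerivAt (fun s : ℝ => x + s • a) a s := by
  simpa using ((hasDerivAt_id s).smul_const a).const_add x

lemma hasDerivAt_line (h : IsMongeAmpereSolution Ω w Dw D2w) {x a : E} {s : ℝ}
    (hx : x + s • a ∈ Ω) : HasDerivAt (fun s : ℝ => w (x + s • a)) ⟪Dw (x + s • a), a⟫ s := by
  exact ((h.hasGradientAt _ hx).hasFDerivAt.comp_hasDerivAt s
    (hasDerivAt_line_aux x a s)).congr_deriv (by simp)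

lemma hasDerivAt_inner_line (h : IsMongeAmpereSolution Ω w Dw D2w) {x a : E} {s : ℝ}
    (hx : x + s • a ∈ Ω) :
    HasDerivAt (fun s : ℝ => ⟪Dw (x + s • a), a⟫) ⟪D2w (x + s • a) a, a⟫ s := by
  have := (h.hasFDerivAt _ hx).comp_hasDerivAt s (hasDerivAt_line_aux x a s)
  simpa using this.inner ℝ (hasDerivAt_const s a)

omit [FiniteDimensional ℝ E] in
lemma tendsto_line (x a : E) : Filter.Tendsto (fun s : ℝ => x + s • a) (nhds 0) (nhds x) := by
  have := (hasDerivAt_line_aux x a 0).continuousAt.tendsto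
  simpa using this

lemma hasJet_line (h : IsMongeAmpereSolution Ω w Dw D2w) {x : E} (hx : x ∈ Ω) (a : E) :
    HasJet (fun s : ℝ => w (x + s • a)) ⟪Dw x, a⟫ ⟪D2w x a, a⟫ := by
  refine ⟨fun s => ⟪Dw (x + s • a), a⟫, ?_, by simp, ?_⟩
  · filter_upwards [tendsto_line x a (h.isOpen.mem_nhds hx)] with s hs using h.hasDerivAt_line hs
  · simpa using h.hasDerivAt_inner_line (x := x) (a := a) (s := 0) (by simpa using hx)

lemma inner_hess_nonneg (h : IsMongeAmpereSolution Ω w Dw D2w) {x : E} (hx : x ∈ Ω) (a : E) :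
    0 ≤ ⟪D2w x a, a⟫ := by
  have hj := (h.hasJet_line hx a).add (h.hasJet_line hx (-a))
  have hm : IsLocalMin (fun s : ℝ => w (x + s • a) + w (x + s • (-a))) 0 := by
    filter_upwards [tendsto_line x a (h.isOpen.mem_nhds hx),
      tendsto_line x (-a) (h.isOpen.mem_nhds hx)] with s hs hs'
    have := h.convexOn.2 (subset_closure hs) (subset_closure hs') (show (0 : ℝ) ≤ 1 / 2 by norm_num)
      (show (0 : ℝ) ≤ 1 / 2 by norm_num) (by norm_num)
    have e : (1 / 2 : ℝ) • (x + s • a) + (1 / 2 : ℝ) • (x + s • -a) = x := by module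
    rw [e] at this
    simp only [zero_smul, add_zero, smul_eq_mul] at this ⊢
    linarith
  have := hj.nonneg_of_isLocalMin hm
  simp only [map_neg, inner_neg_neg] at this
  linarith

lemma norm_sq_le (h : IsMongeAmpereSolution Ω w Dw D2w) (hn : Module.finrank ℝ E = n) {x : E}
    (hx : x ∈ Ω) {L : ℝ} (hL : ∀ a, ⟪D2w x a, a⟫ ≤ L * ‖a‖ ^ 2) (a : E) :
    ‖a‖ ^ 2 ≤ L ^ (n - 1) * ⟪D2w x a, a⟫ :=
  norm_sq_le_of_det_eq_one (h.isSymmetric hx) hn (h.det_eq_one x hx)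
    (h.inner_hess_nonneg hx) hL a

lemma le_norm_sq (h : IsMongeAmpereSolution Ω w Dw D2w) (hn : Module.finrank ℝ E = n) {x : E}
    (hx : x ∈ Ω) {s : ℝ} (hs : 0 ≤ s) (hL : ∀ a, s * ‖a‖ ^ 2 ≤ ⟪D2w x a, a⟫) (a : E) :
    s ^ (n - 1) * ⟪D2w x a, a⟫ ≤ ‖a‖ ^ 2 :=
  le_norm_sq_of_det_eq_one (h.isSymmetric hx) hn (h.det_eq_one x hx) hs hL a

omit [FiniteDimensional ℝ E] in
lemma inner_apply_le_norm_mul (T : E →L[ℝ] E) (a : E) : ⟪T a, a⟫ ≤ ‖T‖ * ‖a‖ ^ 2 :=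
  (real_inner_le_norm _ _).trans <| by
    rw [pow_two, ← mul_assoc]
    gcongr
    exact T.le_opNorm a

lemma inner_hess_pos (h : IsMongeAmpereSolution Ω w Dw D2w) {x : E} (hx : x ∈ Ω) {a : E}
    (ha : a ≠ 0) : 0 < ⟪D2w x a, a⟫ := by
  have := h.norm_sq_le rfl hx (fun a => inner_apply_le_norm_mul _ a) a
  refine (h.inner_hess_nonneg hx a).lt_of_ne fun h0 => ?_
  rw [← h0, mul_zero] at this
  have : 0 < ‖a‖ := norm_pos_iff.2 ha
  nlinarith

lemma exists_isLocalMin {D : Set E} (hD : IsOpen D) (hDb : Bornology.IsBounded D) {f : E → ℝ}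
    (hf : ContinuousOn f (closure D)) (h0 : ∀ x ∈ frontier D, 0 ≤ f x) {y : E}
    (hy : y ∈ closure D) (hfy : f y < 0) : ∃ z ∈ D, IsLocalMin f z ∧ f z < 0 := by
  obtain ⟨z, hz, hm⟩ := hDb.isCompact_closure.exists_isMinOn ⟨y, hy⟩ hf
  have hz0 : f z < 0 := (hm hy).trans_lt hfy
  have hzD : z ∈ D := by
    by_contra hzD
    have : z ∈ frontier D := by rw [hD.frontier_eq]; exact ⟨hz, hzD⟩
    linarith [h0 z this]
  refine ⟨z, hzD, ?_, hz0⟩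
  filter_upwards [hD.mem_nhds hzD] with x hx using hm (subset_closure hx)

omit [FiniteDimensional ℝ E] in
lemma isLocalMin_line {f : E → ℝ} {z : E} (hf : IsLocalMin f z) (a : E) :
    IsLocalMin (fun s : ℝ => f (z + s • a)) 0 := by
  filter_upwards [tendsto_line z a hf] with s hs
  simpa using hs

lemma hess_le (h : IsMongeAmpereSolution Ω w Dw D2w) {z : E} (hz : z ∈ Ω) {q : E → ℝ}
    (hm : IsLocalMin (fun y => q y - w y) z) {a : E} {c d : ℝ}
    (hq : HasJet (fun s : ℝ => q (z + s • a)) c d) : ⟪D2w z a, a⟫ ≤ d := by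
  have := (hq.sub (h.hasJet_line hz a)).nonneg_of_isLocalMin (isLocalMin_line hm a)
  linarith

lemma le_hess (h : IsMongeAmpereSolution Ω w Dw D2w) {z : E} (hz : z ∈ Ω) {q : E → ℝ}
    (hm : IsLocalMin (fun y => w y - q y) z) {a : E} {c d : ℝ}
    (hq : HasJet (fun s : ℝ => q (z + s • a)) c d) : d ≤ ⟪D2w z a, a⟫ := by
  have := ((h.hasJet_line hz a).sub hq).nonneg_of_isLocalMin (isLocalMin_line hm a)
  linarith

omit [FiniteDimensional ℝ E] in
lemma hasJet_norm_sq (z a : E) :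
    HasJet (fun s : ℝ => ‖z + s • a‖ ^ 2) (2 * ⟪z, a⟫) (2 * ‖a‖ ^ 2) := by
  convert hasJet_quadratic (‖z‖ ^ 2) (2 * ⟪z, a⟫) (‖a‖ ^ 2) using 2 with s
  rw [norm_add_sq_real, inner_smul_right, norm_smul, mul_pow, Real.norm_eq_abs, sq_abs]
  ring

lemma nonpos [Nontrivial E] (h : IsMongeAmpereSolution Ω w Dw D2w) {x : E} (hx : x ∈ closure Ω) :
    w x ≤ 0 := by
  by_contra! hw
  obtain ⟨z, hz, hm, -⟩ := exists_isLocalMin h.isOpen h.isBounded (f := fun x => 0 - w x)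
    (continuousOn_const.sub h.continuousOn) (fun x hx => by simp [h.eq_zero x hx]) hx (by linarith)
  obtain ⟨a, ha⟩ := exists_ne (0 : E)
  have := h.hess_le (q := fun _ => 0) hz hm (a := a) (by simpa using hasJet_quadratic 0 0 0)
  linarith [h.inner_hess_pos hz ha]

lemma apply_zero_le [Nontrivial E] (h : IsMongeAmpereSolution Ω w Dw D2w) {r : ℝ} (hr : 0 < r)
    (hrΩ : ball 0 r ⊆ Ω) : w 0 ≤ -(r ^ 2 / 4) := by
  by_contra! hw
  have hcl : closure (ball (0 : E) r) ⊆ closure Ω := closure_mono hrΩ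
  obtain ⟨z, hz, hm, -⟩ := exists_isLocalMin isOpen_ball isBounded_ball
    (f := fun x => 1 / 4 * (‖x‖ ^ 2 - r ^ 2) - w x) (D := ball (0 : E) r) (y := 0)
    ((by fun_prop : Continuous fun x : E => 1 / 4 * (‖x‖ ^ 2 - r ^ 2)).continuousOn.sub
      (h.continuousOn.mono hcl)) (fun x hx => by
        have := h.nonpos (hcl (frontier_subset_closure hx))
        rw [frontier_ball _ hr.ne', mem_sphere_zero_iff_norm] at hx
        rw [hx]; linarith) (subset_closure (mem_ball_self hr)) (by simp; linarith)
  have hj : ∀ a, ⟪D2w z a, a⟫ ≤ 1 / 2 * ‖a‖ ^ 2 := fun a => by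
    have := h.hess_le (q := fun x => 1 / 4 * (‖x‖ ^ 2 - r ^ 2)) (hrΩ hz) hm (a := a)
      (((hasJet_norm_sq z a).sub (hasJet_quadratic (r ^ 2) 0 0)).const_mul (1 / 4) |> fun j => by
        simpa using j)
    linarith
  obtain ⟨a, ha⟩ := exists_ne (0 : E)
  have h1 := h.norm_sq_le rfl (hrΩ hz) hj a
  have h2 := hj a
  have h3 : (1 / 2 : ℝ) ^ (Module.finrank ℝ E - 1) ≤ 1 := pow_le_one₀ (by norm_num) (by norm_num)
  have : 0 < ‖a‖ := norm_pos_iff.2 ha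
  nlinarith [h.inner_hess_nonneg (hrΩ hz) a]

lemma neg_sq_le [Nontrivial E] (h : IsMongeAmpereSolution Ω w Dw D2w) {R : ℝ}
    (hRΩ : Ω ⊆ ball 0 R) {x : E} (hx : x ∈ closure Ω) : -R ^ 2 ≤ w x := by
  by_contra! hw
  have hcl : ∀ x ∈ closure Ω, ‖x‖ ≤ R := fun x hx =>
    mem_closedBall_zero_iff.1 (closure_ball_subset_closedBall (closure_mono hRΩ hx))
  obtain ⟨z, hz, hm, -⟩ := exists_isLocalMin h.isOpen h.isBounded
    (f := fun x => w x - (‖x‖ ^ 2 - R ^ 2)) (y := x)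
    (h.continuousOn.sub (by fun_prop)) (fun x hx => by
        rw [h.eq_zero x hx]
        have := hcl x (frontier_subset_closure hx)
        nlinarith [norm_nonneg x]) hx (by nlinarith [norm_nonneg x])
  have hj : ∀ a, 2 * ‖a‖ ^ 2 ≤ ⟪D2w z a, a⟫ := fun a => by
    have := h.le_hess (q := fun x => (‖x‖ ^ 2 - R ^ 2)) hz hm (a := a)
      (((hasJet_norm_sq z a).sub (hasJet_quadratic (R ^ 2) 0 0)) |> fun j => by
        simpa using j)
    linarith
  obtain ⟨a, ha⟩ := exists_ne (0 : E)
  have h1 := h.le_norm_sq rfl hz (by norm_num) hj a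
  have h2 := hj a
  have h3 : (1 : ℝ) ≤ 2 ^ (Module.finrank ℝ E - 1) := one_le_pow₀ (by norm_num)
  have : 0 < ‖a‖ := norm_pos_iff.2 ha
  nlinarith [h.inner_hess_nonneg hz a]

end IsMongeAmpereSolution

end Solutions

section Solutions

variable {E : Type*} [NormedAddCommGroup E] [InnerProductSpace ℝ E] [FiniteDimensional ℝ E] {n : ℕ}

namespace IsMongeAmpereSolution

variable {Ω : Set E} {w : E → ℝ} {Dw : E → E} {D2w : E → (E →L[ℝ] E)}

lemma add_inner_le (h : IsMongeAmpereSolution Ω w Dw D2w) {x y : E} (hx : x ∈ Ω)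
    (hy : y ∈ closure Ω) : w x + ⟪Dw x, y - x⟫ ≤ w y := by
  have hd := (h.hasJet_line hx (y - x)).hasDerivAt
  rw [hasDerivAt_iff_tendsto_slope] at hd
  have hd' := hd.mono_left (nhdsWithin_mono 0 (s := Ioi (0 : ℝ)) fun s (hs : 0 < s) => hs.ne')
  have : ⟪Dw x, y - x⟫ ≤ w y - w x := by
    refine le_of_tendsto hd' ?_
    filter_upwards [Ioo_mem_nhdsGT (zero_lt_one : (0 : ℝ) < 1)] with s hs
    rw [slope_def_field, sub_zero, div_le_iff₀ hs.1]
    have := h.convexOn.2 (subset_closure hx) hy (show 0 ≤ 1 - s by linarith [hs.2]) hs.1.le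
      (by ring)
    have e : (1 - s) • x + s • y = x + s • (y - x) := by module
    rw [e] at this
    simp only [zero_smul, add_zero, smul_eq_mul] at this ⊢
    linarith
  linarith

lemma norm_gradient_le [Nontrivial E] (h : IsMongeAmpereSolution Ω w Dw D2w)
    (hn : Module.finrank ℝ E = n) {R δ : ℝ} (hR : 0 < R) (hRΩ : Ω ⊆ ball 0 R) (hδ : 0 < δ) {x : E}
    (hx : x ∈ Ω) (hxδ : w x ≤ -δ) :
    ‖Dw x‖ ≤ R + 3 * ((δ / R ^ 2) ^ (n - 1))⁻¹ * R ^ 3 / δ := by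
  have hw := h.neg_sq_le hRΩ (subset_closure hx)
  set k := δ / R ^ 2 with hk
  have hk0 : 0 < k := by positivity
  set K := (k ^ (n - 1))⁻¹ with hK
  have hK0 : 0 < K := by positivity
  rcases eq_or_ne (Dw x) 0 with hp | hp
  · rw [hp, norm_zero]; positivity
  have hp0 : 0 < ‖Dw x‖ := norm_pos_iff.2 hp
  set s := -w x / ‖Dw x‖ with hs
  have hs0 : 0 < s := div_pos (by linarith) hp0
  have hsp : s * ‖Dw x‖ = -w x := div_mul_cancel₀ _ hp0.ne'
  have hrest : 0 < 3 * K * R ^ 3 / δ := by positivity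
  rcases le_or_gt R s with hRs | hRs
  · have : R * ‖Dw x‖ ≤ R * R := by nlinarith
    have := le_of_mul_le_mul_left this hR
    linarith
  set ν := ‖Dw x‖⁻¹ • Dw x with hν
  have hν1 : ‖ν‖ = 1 := by rw [hν, norm_smul, norm_inv, norm_norm, inv_mul_cancel₀ hp0.ne']
  have hcl : ∀ x ∈ closure Ω, ‖x‖ ≤ R := fun x hx =>
    mem_closedBall_zero_iff.1 (closure_ball_subset_closedBall (closure_mono hRΩ hx))
  set σ : E → ℝ := fun y => s + ⟪ν, x - y⟫ with hσ
  have hσ0 : ∀ y ∈ closure Ω, 0 ≤ σ y := fun y hy => by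
    have h1 := h.add_inner_le hx hy
    have h2 := h.nonpos hy
    have e : ⟪Dw x, y - x⟫ = -(‖Dw x‖ * ⟪ν, x - y⟫) := by
      rw [hν, inner_smul_left, ← neg_sub x y, inner_neg_right]
      simp only [conj_trivial]
      field_simp
    have : 0 ≤ ‖Dw x‖ * σ y := by
      simp only [hσ, mul_add]
      linarith
    exact nonneg_of_mul_nonneg_right this hp0
  have hσR : ∀ y ∈ closure Ω, σ y ≤ 3 * R := fun y hy => by
    have h1 := real_inner_le_norm ν (x - y)
    have h2 := norm_sub_le x y
    have h3 := hcl x (subset_closure hx)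
    have h4 := hcl y hy
    rw [hν1, one_mul] at h1
    simp only [hσ]
    linarith
  set q : E → ℝ := fun y => K / 2 * (σ y ^ 2 - 3 * R * σ y) + k / 2 * (‖y‖ ^ 2 - R ^ 2) with hq
  have hq0 : ∀ y ∈ closure Ω, q y ≤ 0 := fun y hy => by
    have h1 : σ y ^ 2 - 3 * R * σ y ≤ 0 := by nlinarith [hσ0 y hy, hσR y hy]
    have h2 : ‖y‖ ^ 2 - R ^ 2 ≤ 0 := by nlinarith [hcl y hy, norm_nonneg y]
    have h3 : K / 2 * (σ y ^ 2 - 3 * R * σ y) ≤ 0 := mul_nonpos_of_nonneg_of_nonpos (by positivity) h1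
    have h4 : k / 2 * (‖y‖ ^ 2 - R ^ 2) ≤ 0 := mul_nonpos_of_nonneg_of_nonpos (by positivity) h2
    simp only [hq]
    linarith
  have hqw : q x ≤ w x := by
    by_contra! hlt
    obtain ⟨z, hz, hm, -⟩ := exists_isLocalMin h.isOpen h.isBounded
      (f := fun x => w x - q x) (y := x)
      (h.continuousOn.sub (by simp only [hq, hσ]; fun_prop)) (fun y hy => by
        rw [h.eq_zero y hy]
        have := hq0 y (frontier_subset_closure hy)
        linarith) (subset_closure hx) (by linarith)
    have hj : ∀ a, K * ⟪ν, a⟫ ^ 2 + k * ‖a‖ ^ 2 ≤ ⟪D2w z a, a⟫ := fun a => by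
      refine h.le_hess (q := q) (c := K / 2 * (-(2 * σ z - 3 * R) * ⟪ν, a⟫) + k * ⟪z, a⟫) hz hm ?_
      convert hasJet_quadratic (q z) (K / 2 * (-(2 * σ z - 3 * R) * ⟪ν, a⟫) + k * ⟪z, a⟫)
        (K / 2 * ⟪ν, a⟫ ^ 2 + k / 2 * ‖a‖ ^ 2) using 2 with t
      · have e : σ (z + t • a) = σ z - t * ⟪ν, a⟫ := by
          simp only [hσ]
          rw [← sub_sub, inner_sub_right, inner_smul_right]; ring
        simp only [hq, e]
        rw [norm_add_sq_real, inner_smul_right, norm_smul, mul_pow, Real.norm_eq_abs, sq_abs]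
        ring
      · ring
    have h1 := h.le_norm_sq hn hz hk0.le (fun a => by nlinarith [hj a, sq_nonneg ⟪ν, a⟫]) ν
    have h2 := hj ν
    rw [real_inner_self_eq_norm_sq, hν1] at h2
    rw [hν1] at h1
    have h3 : k ^ (n - 1) * (K + k) ≤ k ^ (n - 1) * ⟪D2w z ν, ν⟫ :=
      mul_le_mul_of_nonneg_left (by linarith) (by positivity)
    have h4 : k ^ (n - 1) * K = 1 := mul_inv_cancel₀ (by positivity)
    have h5 : 0 < k ^ (n - 1) * k := by positivity
    linarith
  have hqx : q x = K / 2 * (s ^ 2 - 3 * R * s) + k / 2 * (‖x‖ ^ 2 - R ^ 2) := by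
    simp [hq, hσ]
  have hkR : k * R ^ 2 = δ := div_mul_cancel₀ _ (by positivity)
  have h1 : δ ≤ 3 * K * R * s := by
    nlinarith [mul_nonneg hK0.le (sq_nonneg s), mul_nonneg hk0.le (sq_nonneg ‖x‖)]
  have h2 : ‖Dw x‖ ≤ 3 * K * R ^ 3 / δ := by
    rw [le_div_iff₀ hδ]
    calc ‖Dw x‖ * δ ≤ ‖Dw x‖ * (3 * K * R * s) := by gcongr
      _ = 3 * K * R * (s * ‖Dw x‖) := by ring
      _ ≤ 3 * K * R * R ^ 2 := by rw [hsp]; gcongr; linarith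
      _ = _ := by ring
  linarith

/-- Second order Taylor bounds for the symmetric second difference of a solution. -/
lemma second_difference_bounds (h : IsMongeAmpereSolution Ω w Dw D2w) {x e : E} {t m₁ m₂ : ℝ}
    (ht : 0 ≤ t) (hmem : ∀ s ∈ Icc (-t) t, x + s • e ∈ Ω)
    (h1 : ∀ s ∈ Icc (-t) t, m₁ ≤ ⟪D2w (x + s • e) e, e⟫)
    (h2 : ∀ s ∈ Icc (-t) t, ⟪D2w (x + s • e) e, e⟫ ≤ m₂) :
    m₁ * t ^ 2 ≤ w (x + t • e) + w (x + t • (-e)) - 2 * w x ∧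
      w (x + t • e) + w (x + t • (-e)) - 2 * w x ≤ m₂ * t ^ 2 := by
  have hmem' : ∀ s ∈ Icc 0 t, x + s • e ∈ Ω := fun s hs => hmem s ⟨by linarith [hs.1], hs.2⟩
  have hneg : ∀ s ∈ Icc 0 t, -s ∈ Icc (-t) t := fun s hs =>
    ⟨by linarith [hs.2], by linarith [hs.1]⟩
  have hmem'' : ∀ s ∈ Icc 0 t, x + s • (-e) ∈ Ω := fun s hs => by
    have := hmem (-s) (hneg s hs)
    rwa [neg_smul, ← smul_neg] at this
  set f : ℝ → ℝ := fun s => w (x + s • e) + w (x + s • (-e)) - 2 * w x with hf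
  set f' : ℝ → ℝ := fun s => ⟪Dw (x + s • e), e⟫ + ⟪Dw (x + s • (-e)), -e⟫ with hf'
  set f'' : ℝ → ℝ := fun s => ⟪D2w (x + s • e) e, e⟫ + ⟪D2w (x + s • (-e)) (-e), -e⟫ with hf''
  have d1 : ∀ s ∈ Icc 0 t, HasDerivAt f (f' s) s := fun s hs =>
    ((h.hasDerivAt_line (hmem' s hs)).add (h.hasDerivAt_line (hmem'' s hs))).sub_const _
  have d2 : ∀ s ∈ Icc 0 t, HasDerivAt f' (f'' s) s := fun s hs =>
    (h.hasDerivAt_inner_line (hmem' s hs)).add (h.hasDerivAt_inner_line (hmem'' s hs))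
  have g1 : ∀ (c s : ℝ), HasDerivAt (fun s => c * s ^ 2) (2 * c * s) s := fun c s =>
    (((hasDerivAt_id s).pow 2).const_mul c).congr_deriv (by simp; ring)
  have g2 : ∀ (c s : ℝ), HasDerivAt (fun s => 2 * c * s) (2 * c) s := fun c s =>
    ((hasDerivAt_id s).const_mul (2 * c)).congr_deriv (by simp)
  have hb : ∀ s ∈ Icc 0 t, 2 * m₁ ≤ f'' s ∧ f'' s ≤ 2 * m₂ := fun s hs => by
    have e1 : x + s • (-e) = x + (-s) • e := by module
    simp only [hf'', map_neg, inner_neg_neg, e1]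
    have a1 := h1 s ⟨by linarith [hs.1], hs.2⟩
    have a2 := h1 (-s) (hneg s hs)
    have a3 := h2 s ⟨by linarith [hs.1], hs.2⟩
    have a4 := h2 (-s) (hneg s hs)
    constructor <;> linarith
  constructor
  · have := nonneg_of_second_deriv_nonneg ht (f := fun s => f s - m₁ * s ^ 2)
      (fun s hs => (d1 s hs).sub (g1 m₁ s)) (fun s hs => (d2 s hs).sub (g2 m₁ s))
      (fun s hs => by linarith [(hb s hs).1]) (by simp [hf]; ring) (by simp [hf'])
    linarith
  · have := nonneg_of_second_deriv_nonneg ht (f := fun s => m₂ * s ^ 2 - f s)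
      (fun s hs => (g1 m₂ s).sub (d1 s hs)) (fun s hs => (g2 m₂ s).sub (d2 s hs))
      (fun s hs => by linarith [(hb s hs).2]) (by simp [hf]; ring) (by simp [hf'])
    linarith

/-- On a compact subset of the domain, the Hessian varies by a small factor on a small scale. -/
lemma exists_scale (h : IsMongeAmpereSolution Ω w Dw D2w) {K : Set E} (hK : IsCompact K)
    (hKΩ : K ⊆ Ω) : ∃ ρ > 0, ∀ x ∈ K, ∀ y, dist y x ≤ ρ → y ∈ Ω ∧
      ∀ a, 999 / 1000 * ⟪D2w x a, a⟫ ≤ ⟪D2w y a, a⟫ ∧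
        ⟪D2w y a, a⟫ ≤ 1001 / 1000 * ⟪D2w x a, a⟫ := by
  obtain ⟨ρ₁, hρ₁, hsub⟩ := hK.exists_cthickening_subset_open h.isOpen hKΩ
  have hc : IsCompact (cthickening ρ₁ K) := hK.cthickening
  obtain ⟨L, hL⟩ := (hc.bddAbove_image (h.continuousOn_hess.mono hsub).norm)
  have hL' : ∀ x ∈ K, ‖D2w x‖ ≤ |L| + 1 := fun x hx => by
    have := hL (mem_image_of_mem _ (self_subset_cthickening K hx))
    linarith [le_abs_self L]
  set L' := |L| + 1
  have hL0 : 0 < L' := by positivity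
  set n := Module.finrank ℝ E
  have hlow : ∀ x ∈ K, ∀ a, ‖a‖ ^ 2 ≤ L' ^ (n - 1) * ⟪D2w x a, a⟫ := fun x hx a =>
    h.norm_sq_le rfl (hKΩ hx) (fun a => (inner_apply_le_norm_mul _ a).trans (by
      gcongr; exact hL' x hx)) a
  have huc := hc.uniformContinuousOn_of_continuous (h.continuousOn_hess.mono hsub)
  rw [Metric.uniformContinuousOn_iff] at huc
  obtain ⟨ρ₂, hρ₂, huc⟩ := huc (1 / 1000 / L' ^ (n - 1)) (by positivity)
  refine ⟨min ρ₁ (ρ₂ / 2), by positivity, fun x hx y hxy => ?_⟩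
  have hy : y ∈ cthickening ρ₁ K :=
    mem_cthickening_of_dist_le y x ρ₁ K hx (hxy.trans (min_le_left _ _))
  refine ⟨hsub hy, fun a => ?_⟩
  have h1 := huc y hy x (self_subset_cthickening K hx)
    ((hxy.trans (min_le_right _ _)).trans_lt (by linarith))
  rw [dist_eq_norm] at h1
  have h2 : |⟪D2w y a, a⟫ - ⟪D2w x a, a⟫| ≤ 1 / 1000 * ⟪D2w x a, a⟫ := by
    rw [← inner_sub_left, ← _root_.sub_apply]
    calc |⟪(D2w y - D2w x) a, a⟫| ≤ ‖(D2w y - D2w x) a‖ * ‖a‖ := abs_real_inner_le_norm _ _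
      _ ≤ ‖D2w y - D2w x‖ * ‖a‖ * ‖a‖ := by gcongr; exact ContinuousLinearMap.le_opNorm _ _
      _ = ‖D2w y - D2w x‖ * ‖a‖ ^ 2 := by ring
      _ ≤ 1 / 1000 / L' ^ (n - 1) * (L' ^ (n - 1) * ⟪D2w x a, a⟫) := by
        gcongr
        exact hlow x hx a
      _ = _ := by field_simp
  rw [abs_le] at h2
  constructor <;> linarith [h2.1, h2.2]

end IsMongeAmpereSolution

end Solutions

section Solutions

variable {E : Type*} [NormedAddCommGroup E] [InnerProductSpace ℝ E] [FiniteDimensional ℝ E] {n : ℕ}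

/-- The symmetric second difference of `w` at `P.1` in the direction `e`, with step `P.2`. -/
def secondDifference (w : E → ℝ) (e : E) (P : E × ℝ) : ℝ :=
  w (P.1 + P.2 • e) + w (P.1 + P.2 • (-e)) - 2 * w P.1

/-- The logarithm of the auxiliary function used in the interior second derivative estimate. -/
def logAuxiliary (w : E → ℝ) (e : E) (h δ A : ℝ) (N : ℕ) (P : E × ℝ) : ℝ :=
  Real.log (secondDifference w e P) - 2 * Real.log P.2 - 1 / 50 * (P.2 / h - 1) ^ 2
    + N * Real.log (-w P.1 - δ) + A / 2 * ‖P.1‖ ^ 2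

/-- The auxiliary function used in the interior second derivative estimate. -/
def auxiliary (w : E → ℝ) (e : E) (h δ A : ℝ) (N : ℕ) (P : E × ℝ) : ℝ :=
  secondDifference w e P / P.2 ^ 2 * Real.exp (-(1 / 50 * (P.2 / h - 1) ^ 2)) * (-w P.1 - δ) ^ N
    * Real.exp (A / 2 * ‖P.1‖ ^ 2)

namespace IsMongeAmpereSolution

variable {Ω : Set E} {w : E → ℝ} {Dw : E → E} {D2w : E → (E →L[ℝ] E)}

lemma second_order_condition (hs : IsMongeAmpereSolution Ω w Dw D2w) {x e : E} {t h δ A : ℝ} {N : ℕ}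
    (hx : x ∈ Ω) (hy : x + t • e ∈ Ω) (hz : x + t • (-e) ∈ Ω)
    (hM : 0 < secondDifference w e (x, t)) (ht : 0 < t) (hu : 0 < -w x - δ)
    (hmax : IsLocalMax (logAuxiliary w e h δ A N) (x, t)) (ξ : E) (ν : ℝ) :
    (⟪D2w (x + t • e) ξ, ξ⟫ + ⟪D2w (x + t • (-e)) ξ, ξ⟫ - 2 * ⟪D2w x ξ, ξ⟫
        + 2 * ν * t * ⟪(D2w (x + t • e) - D2w (x + t • (-e))) ξ, e⟫
        + ν ^ 2 * t ^ 2 * (⟪D2w (x + t • e) e, e⟫ + ⟪D2w (x + t • (-e)) e, e⟫))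
          / secondDifference w e (x, t)
        - ((N * ⟪Dw x, ξ⟫ / (-w x - δ) - A * ⟪x, ξ⟫)
          + ν * (2 + 2 * (1 / 50) * (t / h) * (t / h - 1))) ^ 2
        + (2 - 2 * (1 / 50) * (t / h) ^ 2) * ν ^ 2
        ≤ N * ⟪D2w x ξ, ξ⟫ / (-w x - δ) + N * (⟪Dw x, ξ⟫ / (-w x - δ)) ^ 2 - A * ‖ξ‖ ^ 2 := by
  have hc : Filter.Tendsto (fun s : ℝ => (x + s • ξ, t + s * (t * ν))) (nhds 0) (nhds (x, t)) := by
    have : Continuous (fun s : ℝ => (x + s • ξ, t + s * (t * ν))) := by fun_prop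
    simpa using this.tendsto 0
  have hmax' : IsLocalMax (fun s : ℝ => logAuxiliary w e h δ A N (x + s • ξ, t + s * (t * ν))) 0 := by
    filter_upwards [hc hmax] with s hs
    simpa using hs
  have j0 : HasJet (fun s : ℝ => secondDifference w e (x + s • ξ, t + s * (t * ν)))
      (⟪Dw (x + t • e), ξ + (t * ν) • e⟫ + ⟪Dw (x + t • (-e)), ξ + (t * ν) • (-e)⟫
        - 2 * ⟪Dw x, ξ⟫)
      (⟪D2w (x + t • e) (ξ + (t * ν) • e), ξ + (t * ν) • e⟫
        + ⟪D2w (x + t • (-e)) (ξ + (t * ν) • (-e)), ξ + (t * ν) • (-e)⟫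
        - 2 * ⟪D2w x ξ, ξ⟫) := by
    have := ((hs.hasJet_line hy (ξ + (t * ν) • e)).add
      (hs.hasJet_line hz (ξ + (t * ν) • (-e)))).sub ((hs.hasJet_line hx ξ).const_mul 2)
    have e1 : ∀ (s : ℝ) (a : E), x + s • ξ + (t + s * (t * ν)) • a =
        x + t • a + s • (ξ + (t * ν) • a) := fun s a => by module
    simpa only [secondDifference, e1] using this
  have j1 := j0.log (by simpa using hM.ne')
  have j2 := ((hasJet_quadratic t (t * ν) 0).log (by simpa using ht.ne')).const_mul 2
  have j3 := hasJet_quadratic (1 / 50 * (t / h - 1) ^ 2) (1 / 50 * 2 * (t / h - 1) * (t / h * ν))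
    (1 / 50 * (t / h * ν) ^ 2)
  have j4 := (((hasJet_quadratic (-δ) 0 0).sub (hs.hasJet_line hx ξ)).log
    (by simp; linarith)).const_mul N
  have j5 := (hasJet_norm_sq x ξ).const_mul (A / 2)
  have j := (((j1.sub j2).sub j3).add j4).add j5
  have efun : ∀ s : ℝ, logAuxiliary w e h δ A N (x + s • ξ, t + s * (t * ν)) =
      Real.log (secondDifference w e (x + s • ξ, t + s * (t * ν)))
      - 2 * Real.log (t + t * ν * s + 0 * s ^ 2)
      - (1 / 50 * (t / h - 1) ^ 2 + 1 / 50 * 2 * (t / h - 1) * (t / h * ν) * s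
          + 1 / 50 * (t / h * ν) ^ 2 * s ^ 2)
      + N * Real.log (-δ + 0 * s + 0 * s ^ 2 - w (x + s • ξ))
      + A / 2 * ‖x + s • ξ‖ ^ 2 := fun s => by
    simp only [logAuxiliary]
    rw [show t + t * ν * s + 0 * s ^ 2 = t + s * (t * ν) by ring,
      show -δ + 0 * s + 0 * s ^ 2 - w (x + s • ξ) = -w (x + s • ξ) - δ by ring]
    ring
  have jn := (funext efun ▸ j).const_mul (-1)
  have hmin : IsLocalMin (fun s : ℝ => -1 *
      logAuxiliary w e h δ A N (x + s • ξ, t + s * (t * ν))) 0 := by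
    simpa using hmax'.neg
  have k1 := jn.eq_zero_of_isLocalMin hmin
  have k2 := jn.nonneg_of_isLocalMin hmin
  have eQ : ⟪D2w (x + t • e) (ξ + (t * ν) • e), ξ + (t * ν) • e⟫
        + ⟪D2w (x + t • (-e)) (ξ + (t * ν) • (-e)), ξ + (t * ν) • (-e)⟫ - 2 * ⟪D2w x ξ, ξ⟫ =
      ⟪D2w (x + t • e) ξ, ξ⟫ + ⟪D2w (x + t • (-e)) ξ, ξ⟫ - 2 * ⟪D2w x ξ, ξ⟫
        + 2 * ν * t * ⟪(D2w (x + t • e) - D2w (x + t • (-e))) ξ, e⟫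
        + ν ^ 2 * t ^ 2 * (⟪D2w (x + t • e) e, e⟫ + ⟪D2w (x + t • (-e)) e, e⟫) := by
    have s1 : ⟪D2w (x + t • e) e, ξ⟫ = ⟪D2w (x + t • e) ξ, e⟫ := by
      rw [real_inner_comm]; exact (hs.isSymmetric hy ξ e).symm
    have s2 : ⟪D2w (x + t • (-e)) e, ξ⟫ = ⟪D2w (x + t • (-e)) ξ, e⟫ := by
      rw [real_inner_comm]; exact (hs.isSymmetric hz ξ e).symm
    simp only [map_add, map_smul, map_neg, inner_add_left, inner_add_right, inner_smul_left,
      inner_smul_right, inner_neg_left, inner_neg_right, _root_.sub_apply, inner_sub_left,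
      conj_trivial, s1, s2]
    ring
  rw [eQ] at k2
  simp only [zero_smul, add_zero, zero_mul, mul_zero] at k1 k2
  set p := ⟪Dw (x + t • e), ξ + (t * ν) • e⟫ + ⟪Dw (x + t • (-e)), ξ + (t * ν) • (-e)⟫
        - 2 * ⟪Dw x, ξ⟫
  set M := secondDifference w e (x, t)
  set u := -w x - δ with hudef
  have e3 : -δ - w x = u := by rw [hudef]; ring
  have e4 : t * ν / t = ν := by field_simp
  rw [e3, e4] at k1 k2
  have e5 : p / M = N * ⟪Dw x, ξ⟫ / u - A * ⟪x, ξ⟫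
      + ν * (2 + 2 * (1 / 50) * (t / h) * (t / h - 1)) := by
    linear_combination -k1
  rw [e5] at k2
  linear_combination k2

lemma exists_maximum [Nontrivial E] (hs : IsMongeAmpereSolution Ω w Dw D2w) {δ : ℝ} (hδ : 0 < δ)
    {N : ℕ} (hN : N ≠ 0) (A : ℝ) (h0 : 0 ∈ Ω) (hw0 : w 0 < -δ) {e : E} (he : ‖e‖ = 1) :
    ∃ h t : ℝ, ∃ x ∈ Ω, 0 < h ∧ h / 2 < t ∧ t < 3 * h / 2 ∧ 0 < -w x - δ ∧
      x + t • e ∈ Ω ∧ x + t • (-e) ∈ Ω ∧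
      (∀ a, 999 / 1000 * ⟪D2w x a, a⟫ ≤ ⟪D2w (x + t • e) a, a⟫ ∧
        ⟪D2w (x + t • e) a, a⟫ ≤ 1001 / 1000 * ⟪D2w x a, a⟫) ∧
      (∀ a, 999 / 1000 * ⟪D2w x a, a⟫ ≤ ⟪D2w (x + t • (-e)) a, a⟫ ∧
        ⟪D2w (x + t • (-e)) a, a⟫ ≤ 1001 / 1000 * ⟪D2w x a, a⟫) ∧
      999 / 1000 * (t ^ 2 * ⟪D2w x e, e⟫) ≤ secondDifference w e (x, t) ∧
      IsLocalMax (logAuxiliary w e h δ A N) (x, t) ∧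
      999 / 1000 * ⟪D2w 0 e, e⟫ * (-w 0 - δ) ^ N ≤
        1001 / 1000 * ⟪D2w x e, e⟫ * (-w x - δ) ^ N * Real.exp (A / 2 * ‖x‖ ^ 2) := by
  have he0 : e ≠ 0 := by rintro rfl; simp at he
  set K := closure Ω ∩ w ⁻¹' Iic (-δ) with hKdef
  have hK : IsCompact K := hs.isBounded.isCompact_closure.of_isClosed_subset
    (hs.continuousOn.preimage_isClosed_of_isClosed isClosed_closure isClosed_Iic)
    inter_subset_left
  have hKΩ : K ⊆ Ω := fun x hx => by
    by_contra hxΩ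
    have h1 := hs.eq_zero x (by rw [hs.isOpen.frontier_eq]; exact ⟨hx.1, hxΩ⟩)
    have h2 : w x ≤ -δ := hx.2
    linarith
  have h0K : (0 : E) ∈ K := ⟨subset_closure h0, hw0.le⟩
  obtain ⟨ρ, hρ, hscale⟩ := hs.exists_scale hK hKΩ
  set h := ρ / 2 with hh
  have hh0 : 0 < h := by positivity
  have hdist : ∀ (x : E) (t : ℝ), dist (x + t • e) x = |t| := fun x t => by
    rw [dist_eq_norm, add_sub_cancel_left, norm_smul, he, mul_one, Real.norm_eq_abs]
  have hline : ∀ x ∈ K, ∀ t, |t| ≤ 3 * h / 2 → x + t • e ∈ Ω ∧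
      ∀ a, 999 / 1000 * ⟪D2w x a, a⟫ ≤ ⟪D2w (x + t • e) a, a⟫ ∧
        ⟪D2w (x + t • e) a, a⟫ ≤ 1001 / 1000 * ⟪D2w x a, a⟫ := fun x hx t ht =>
    hscale x hx _ (by rw [hdist]; linarith)
  have hneg : ∀ (x : E) (t : ℝ), x + t • (-e) = x + (-t) • e := fun x t => by module
  have hM : ∀ x ∈ K, ∀ t ∈ Icc (h / 2) (3 * h / 2),
      999 / 1000 * ⟪D2w x e, e⟫ * t ^ 2 ≤ secondDifference w e (x, t) ∧
      secondDifference w e (x, t) ≤ 1001 / 1000 * ⟪D2w x e, e⟫ * t ^ 2 := fun x hx t ht => by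
    have hab : ∀ s ∈ Icc (-t) t, |s| ≤ 3 * h / 2 := fun s hs' =>
      (abs_le.2 ⟨hs'.1, hs'.2⟩).trans ht.2
    exact hs.second_difference_bounds (by linarith [ht.1]) (fun s hs' => (hline x hx s (hab s hs')).1)
      (fun s hs' => ((hline x hx s (hab s hs')).2 e).1)
      (fun s hs' => ((hline x hx s (hab s hs')).2 e).2)
  have hm : ∀ x ∈ K, 0 < ⟪D2w x e, e⟫ := fun x hx => hs.inner_hess_pos (hKΩ hx) he0
  have hMpos : ∀ x ∈ K, ∀ t ∈ Icc (h / 2) (3 * h / 2), 0 < secondDifference w e (x, t) :=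
    fun x hx t ht => by
      have ht0 : 0 < t := by linarith [ht.1]
      have := hm x hx
      exact lt_of_lt_of_le (by positivity) (hM x hx t ht).1
  have habs : ∀ t ∈ Icc (h / 2) (3 * h / 2), |t| ≤ 3 * h / 2 := fun t ht => by
    rw [abs_of_nonneg (by linarith [ht.1])]; exact ht.2
  have hcont : ContinuousOn (auxiliary w e h δ A N) (K ×ˢ Icc (h / 2) (3 * h / 2)) := by
    have c1 : ContinuousOn w Ω := hs.continuousOn.mono subset_closure
    have c2 : ContinuousOn (fun P : E × ℝ => w P.1) (K ×ˢ Icc (h / 2) (3 * h / 2)) :=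
      c1.comp continuousOn_fst fun P hP => hKΩ hP.1
    have c3 : ContinuousOn (fun P : E × ℝ => w (P.1 + P.2 • e)) (K ×ˢ Icc (h / 2) (3 * h / 2)) :=
      c1.comp (by fun_prop) fun P hP => (hline _ hP.1 _ (habs _ hP.2)).1
    have c4 : ContinuousOn (fun P : E × ℝ => w (P.1 + P.2 • (-e)))
        (K ×ˢ Icc (h / 2) (3 * h / 2)) :=
      c1.comp (by fun_prop) fun P hP => by
        rw [hneg]
        exact (hline _ hP.1 _ (by rw [abs_neg]; exact habs _ hP.2)).1
    have c5 : ContinuousOn (secondDifference w e) (K ×ˢ Icc (h / 2) (3 * h / 2)) :=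
      (c3.add c4).sub (continuousOn_const.mul c2)
    refine (((c5.div (by fun_prop) fun P hP => ?_).mul (by fun_prop)).mul
      ((c2.neg.sub continuousOn_const).pow N)).mul (by fun_prop)
    have : 0 < P.2 := by linarith [hP.2.1]
    positivity
  have h0h : h ∈ Icc (h / 2) (3 * h / 2) := ⟨by linarith, by linarith⟩
  obtain ⟨⟨x, t⟩, hxt, hmax⟩ := (hK.prod isCompact_Icc).exists_isMaxOn ⟨(0, h), h0K, h0h⟩ hcont
  obtain ⟨hx, ht⟩ : x ∈ K ∧ t ∈ Icc (h / 2) (3 * h / 2) := hxt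
  have ht0 : 0 < t := by linarith [ht.1]
  have hmax' : ∀ y ∈ K, ∀ s ∈ Icc (h / 2) (3 * h / 2),
      auxiliary w e h δ A N (y, s) ≤ auxiliary w e h δ A N (x, t) := fun y hy s hs' =>
    hmax (show (y, s) ∈ K ×ˢ Icc (h / 2) (3 * h / 2) from ⟨hy, hs'⟩)
  have hpos : ∀ y ∈ K, 0 < -w y - δ → ∀ s ∈ Icc (h / 2) (3 * h / 2),
      0 < auxiliary w e h δ A N (y, s) := fun y hy hy' s hs' => by
    have := hMpos y hy s hs'
    have hs0 : 0 < s := by linarith [hs'.1]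
    simp only [auxiliary]
    positivity
  have hu : 0 < -w x - δ := by
    have h1 := (hpos 0 h0K (by linarith) h h0h).trans_le (hmax' 0 h0K h h0h)
    have h2 : w x ≤ -δ := hx.2
    rcases (show (0 : ℝ) ≤ -w x - δ by linarith).eq_or_lt with h3 | h3
    · simp [auxiliary, ← h3, hN] at h1
    · exact h3
  have hlog : ∀ y ∈ K, 0 < -w y - δ → ∀ s ∈ Icc (h / 2) (3 * h / 2),
      Real.log (auxiliary w e h δ A N (y, s)) = logAuxiliary w e h δ A N (y, s) :=
    fun y hy hy' s hs' => by
      have := hMpos y hy s hs'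
      have hs0 : 0 < s := by linarith [hs'.1]
      simp only [auxiliary, logAuxiliary]
      rw [Real.log_mul (by positivity) (by positivity), Real.log_mul (by positivity) (by positivity),
        Real.log_mul (by positivity) (by positivity), Real.log_div (by positivity) (by positivity),
        Real.log_exp, Real.log_exp, Real.log_pow, Real.log_pow]
      push_cast
      ring
  have hmx := hm x hx
  have hexp : 999 / 1000 ≤ 1001 / 1000 * Real.exp (-(1 / 50 * (t / h - 1) ^ 2)) := by
    have h1 := hmax' x hx h h0h
    simp only [auxiliary] at h1
    have h2 := le_of_mul_le_mul_right h1 (Real.exp_pos _)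
    have h3 := le_of_mul_le_mul_right h2 (by positivity)
    rw [div_self hh0.ne'] at h3
    norm_num at h3
    have h4 : 999 / 1000 * ⟪D2w x e, e⟫ ≤ secondDifference w e (x, h) / h ^ 2 := by
      rw [le_div_iff₀ (by positivity)]; exact (hM x hx h h0h).1
    have h5 : secondDifference w e (x, t) / t ^ 2 ≤ 1001 / 1000 * ⟪D2w x e, e⟫ := by
      rw [div_le_iff₀ (by positivity)]; exact (hM x hx t ht).2
    have h6 := mul_le_mul_of_nonneg_right h5
      (Real.exp_pos (-(1 / 50 * (t / h - 1) ^ 2))).le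
    have h7 : 999 / 1000 * ⟪D2w x e, e⟫ ≤
        1001 / 1000 * Real.exp (-(1 / 50 * (t / h - 1) ^ 2)) * ⟪D2w x e, e⟫ := by
      norm_num at h3 h4 h6 ⊢
      linarith
    exact le_of_mul_le_mul_right h7 hmx
  have hτ : (t / h - 1) ^ 2 < 1 / 4 := by
    by_contra! hcon
    have h1 : Real.exp (-(1 / 50 * (t / h - 1) ^ 2)) ≤ Real.exp (-(1 / 200)) :=
      Real.exp_le_exp.2 (by linarith)
    have h2 := Real.add_one_le_exp (1 / 200)
    have h3 : Real.exp (-(1 / 200)) * Real.exp (1 / 200) = 1 := by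
      rw [← Real.exp_add]; simp
    nlinarith [Real.exp_pos (-(1 / 200))]
  have ht1 : h / 2 < t ∧ t < 3 * h / 2 := by
    have h1 := abs_lt_of_sq_lt_sq' (show (t / h - 1) ^ 2 < (1 / 2) ^ 2 by linarith) (by norm_num)
    have h2 : t / h * h = t := div_mul_cancel₀ _ hh0.ne'
    constructor <;> nlinarith [h1.1, h1.2]
  refine ⟨h, t, x, hKΩ hx, hh0, ht1.1, ht1.2, hu, (hline x hx t (habs t ht)).1, ?_,
    (hline x hx t (habs t ht)).2, ?_, ?_, ?_, ?_⟩
  · rw [hneg]; exact (hline x hx _ (by rw [abs_neg]; exact habs t ht)).1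
  · rw [hneg]; exact (hline x hx _ (by rw [abs_neg]; exact habs t ht)).2
  · linarith [(hM x hx t ht).1]
  · have hnhds : ∀ᶠ P : E × ℝ in nhds (x, t), (P.1 ∈ Ω ∧ w P.1 < -δ) ∧
        P.2 ∈ Ioo (h / 2) (3 * h / 2) := by
      have hcx : ContinuousAt w x :=
        (hs.continuousOn.mono subset_closure).continuousAt (hs.isOpen.mem_nhds (hKΩ hx))
      have h1 : ∀ᶠ y in nhds x, y ∈ Ω ∧ w y < -δ :=
        (hs.isOpen.eventually_mem (hKΩ hx)).and (hcx.eventually_lt_const (by linarith))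
      have h2 : ∀ᶠ s in nhds t, s ∈ Ioo (h / 2) (3 * h / 2) := Ioo_mem_nhds ht1.1 ht1.2
      exact Filter.Eventually.prod_nhds h1 h2
    filter_upwards [hnhds] with P hP
    have hPK : P.1 ∈ K := ⟨subset_closure hP.1.1, hP.1.2.le⟩
    have hPt : P.2 ∈ Icc (h / 2) (3 * h / 2) := Ioo_subset_Icc_self hP.2
    have hPu : 0 < -w P.1 - δ := by linarith [hP.1.2]
    have e1 := hlog P.1 hPK hPu P.2 hPt
    rw [← hlog x hx hu t ht, ← e1]
    exact Real.log_le_log (hpos _ hPK hPu _ hPt) (hmax' _ hPK _ hPt)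
  · have h1 := hmax' 0 h0K h h0h
    have h2 : 999 / 1000 * ⟪D2w 0 e, e⟫ ≤ secondDifference w e (0, h) / h ^ 2 := by
      rw [le_div_iff₀ (by positivity)]; exact (hM 0 h0K h h0h).1
    have h3 : secondDifference w e (x, t) / t ^ 2 ≤ 1001 / 1000 * ⟪D2w x e, e⟫ := by
      rw [div_le_iff₀ (by positivity)]; exact (hM x hx t ht).2
    have h4 : Real.exp (-(1 / 50 * (t / h - 1) ^ 2)) ≤ 1 := Real.exp_le_one_iff.2 (by
      have := sq_nonneg (t / h - 1)
      linarith)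
    have hu0 : 0 < -w 0 - δ := by linarith
    calc 999 / 1000 * ⟪D2w 0 e, e⟫ * (-w 0 - δ) ^ N
        ≤ secondDifference w e (0, h) / h ^ 2 * (-w 0 - δ) ^ N := by gcongr
      _ = auxiliary w e h δ A N (0, h) := by simp [auxiliary, div_self hh0.ne']
      _ ≤ auxiliary w e h δ A N (x, t) := h1
      _ ≤ 1001 / 1000 * ⟪D2w x e, e⟫ * 1 * (-w x - δ) ^ N * Real.exp (A / 2 * ‖x‖ ^ 2) := by
        simp only [auxiliary]
        gcongr
      _ = _ := by ring

lemma mul_pow_le_of_trace_bound {m S u U B C₂ : ℝ} {n : ℕ} (hn : 0 < n) (hS : 0 ≤ S)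
    (hmS : m ≤ S ^ (n - 1)) (hu : 0 < u) (huU : u ≤ U) (hC₂ : 1 ≤ m * u → S ≤ C₂ / u)
    (hB : U ^ (n + 3) + C₂ ^ (n - 1) * U ^ 5 ≤ B) (hC₂0 : 0 ≤ C₂) : m * u ^ (n + 4) ≤ B := by
  have hU : 0 < U := hu.trans_le huU
  rcases le_or_gt (m * u) 1 with h | h
  · calc m * u ^ (n + 4) = m * u * u ^ (n + 3) := by ring
      _ ≤ 1 * U ^ (n + 3) := by gcongr
      _ ≤ U ^ (n + 3) + C₂ ^ (n - 1) * U ^ 5 := by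
        have : 0 ≤ C₂ ^ (n - 1) * U ^ 5 := by positivity
        linarith
      _ ≤ B := hB
  · calc m * u ^ (n + 4) ≤ (C₂ / u) ^ (n - 1) * u ^ (n + 4) := by
          gcongr
          exact hmS.trans (by gcongr; exact hC₂ h.le)
      _ = C₂ ^ (n - 1) * u ^ 5 := by
        obtain ⟨k, rfl⟩ := Nat.exists_eq_succ_of_ne_zero hn.ne'
        simp only [Nat.succ_eq_add_one, Nat.add_sub_cancel]
        rw [div_pow]
        field_simp
        ring
      _ ≤ C₂ ^ (n - 1) * U ^ 5 := by gcongr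
      _ ≤ U ^ (n + 3) + C₂ ^ (n - 1) * U ^ 5 := by
        have : 0 ≤ U ^ (n + 3) := by positivity
        linarith
      _ ≤ B := hB

set_option maxHeartbeats 1000000 in
/-- Pogorelov's interior second derivative estimate, at the origin of a domain comparable to a
ball. -/
theorem exists_hess_bound (n : ℕ) {r R : ℝ} (hr : 0 < r) (hR : 0 < R) : ∃ C > 0,
    ∀ {E : Type*} [NormedAddCommGroup E] [InnerProductSpace ℝ E] [FiniteDimensional ℝ E]
      [Nontrivial E] {Ω : Set E} {w : E → ℝ} {Dw : E → E} {D2w : E → (E →L[ℝ] E)},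
      Module.finrank ℝ E = n → IsMongeAmpereSolution Ω w Dw D2w → ball 0 r ⊆ Ω → Ω ⊆ ball 0 R →
      ∀ a, ⟪D2w 0 a, a⟫ ≤ C * ‖a‖ ^ 2 := by
  set δ := r ^ 2 / 8 with hδ
  have hδ0 : 0 < δ := by positivity
  set A := 1 / (4 * R ^ 2) with hA
  have hA0 : 0 < A := by positivity
  set β : ℝ := ((n + 4 : ℕ) : ℝ) with hβ
  have hβ0 : 0 ≤ β := Nat.cast_nonneg _
  set G := R + 3 * ((δ / R ^ 2) ^ (n - 1))⁻¹ * R ^ 3 / δ with hG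
  set C₂ := 2 / A * (β * n + (2 * β ^ 2 + β) * G ^ 2) with hC₂
  have hC₂0 : 0 ≤ C₂ := by positivity
  set B := (R ^ 2) ^ (n + 3) + C₂ ^ (n - 1) * (R ^ 2) ^ 5 with hB
  have hB0 : 0 < B := by positivity
  refine ⟨4 * B / δ ^ (n + 4), by positivity, ?_⟩
  intro E _ _ _ _ Ω w Dw D2w hn hs hrΩ hRΩ a
  have h0 : (0 : E) ∈ Ω := hrΩ (mem_ball_self hr)
  have hn0 : 0 < n := hn ▸ Module.finrank_pos
  have hw0 := hs.apply_zero_le hr hrΩ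
  have key : ∀ e : E, ‖e‖ = 1 → ⟪D2w 0 e, e⟫ ≤ 4 * B / δ ^ (n + 4) := fun e he => by
    obtain ⟨h, t, x, hx, hh, ht1, ht2, hu, hy, hz, hY, hZ, hM, hmax, hfin⟩ :=
      hs.exists_maximum hδ0 (N := n + 4) (by omega) A h0 (by linarith) he
    have he0 : e ≠ 0 := by rintro rfl; simp at he
    have ht : 0 < t := by linarith
    have hm := hs.inner_hess_pos hx he0
    have hMpos : 0 < secondDifference w e (x, t) := lt_of_lt_of_le (by positivity) hM
    have hτ1 : 1 / 2 < t / h := by rw [lt_div_iff₀ hh]; linarith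
    have hτ2 : t / h < 3 / 2 := by rw [div_lt_iff₀ hh]; linarith
    have hxR : ‖x‖ ≤ R := (mem_ball_zero_iff.1 (hRΩ hx)).le
    obtain ⟨S, hS0, hmS, hS⟩ := trace_bound_of_second_order (hs.isSymmetric hx) (hs.isSymmetric hy)
      (hs.isSymmetric hz) hn (hs.det_eq_one x hx) (hs.det_eq_one _ hy) (hs.det_eq_one _ hz)
      (fun a ha => hs.inner_hess_pos hx ha) (fun a => (hY a).1) (fun a => (hY a).2)
      (fun a => (hZ a).1) (fun a => (hZ a).2) (p := Dw x) (x := x) he hMpos hM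
      (t := t) (κ := 2 - 2 * (1 / 50) * (t / h) ^ 2)
      (μ := 2 + 2 * (1 / 50) * (t / h) * (t / h - 1)) (u := -w x - δ) (β := β)
      (by nlinarith) (by
        have : -(1 / 4) ≤ t / h * (t / h - 1) := by nlinarith [sq_nonneg (t / h - 1 / 2)]
        have : t / h * (t / h - 1) ≤ 3 / 4 := by nlinarith
        nlinarith) (by rw [hβ]; push_cast; linarith [(Nat.cast_nonneg n : (0 : ℝ) ≤ n)])
      hR hxR hA (hs.second_order_condition hx hy hz hMpos ht hu hmax)
    set m := ⟪D2w x e, e⟫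
    change m ≤ S ^ (n - 1) at hmS
    change A / 2 * S ≤ β * n / (-w x - δ) + (2 * β ^ 2 + β) * (⟪Dw x, e⟫ / (-w x - δ)) ^ 2 / m at hS
    have hxU := hs.neg_sq_le hRΩ (subset_closure hx)
    have hgrad : ⟪Dw x, e⟫ ^ 2 ≤ G ^ 2 := by
      have h1 := hs.norm_gradient_le hn hR hRΩ hδ0 hx (by linarith)
      have h2 := abs_real_inner_le_norm (Dw x) e
      rw [he, mul_one] at h2
      rw [← sq_abs]
      gcongr
      exact h2.trans h1
    set u := -w x - δ with hu_def
    have hmain : m * u ^ (n + 4) ≤ B := by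
      refine mul_pow_le_of_trace_bound hn0 hS0 hmS hu (U := R ^ 2) (by linarith)
        (fun hmu => ?_) le_rfl hC₂0
      have h1 : (⟪Dw x, e⟫ / u) ^ 2 / m ≤ G ^ 2 / u := by
        rw [div_pow, div_div, div_le_div_iff₀ (by positivity) hu]
        calc ⟪Dw x, e⟫ ^ 2 * u ≤ G ^ 2 * u * 1 := by rw [mul_one]; gcongr
          _ ≤ G ^ 2 * u * (m * u) := by gcongr
          _ = _ := by ring
      have h2 : A / 2 * S ≤ (β * n + (2 * β ^ 2 + β) * G ^ 2) / u := by
        refine hS.trans ?_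
        rw [add_div, mul_div_assoc (2 * β ^ 2 + β), mul_div_assoc (2 * β ^ 2 + β)]
        gcongr
      calc S = 2 / A * (A / 2 * S) := by field_simp
        _ ≤ 2 / A * ((β * n + (2 * β ^ 2 + β) * G ^ 2) / u) := by gcongr
        _ = C₂ / u := by rw [hC₂]; ring
    have hexp : Real.exp (A / 2 * ‖x‖ ^ 2) ≤ 3 := by
      have h1 : A / 2 * ‖x‖ ^ 2 ≤ 1 := by
        calc A / 2 * ‖x‖ ^ 2 ≤ A / 2 * R ^ 2 := by gcongr
          _ = 1 / 8 := by rw [hA]; field_simp; norm_num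
          _ ≤ 1 := by norm_num
      exact (Real.exp_le_exp.2 h1).trans (by linarith [Real.exp_one_lt_d9])
    have hm0 := hs.inner_hess_nonneg h0 e
    have hd : δ ^ (n + 4) ≤ (-w 0 - δ) ^ (n + 4) := by
      gcongr
      linarith
    rw [le_div_iff₀ (by positivity)]
    have h1 : 999 / 1000 * ⟪D2w 0 e, e⟫ * δ ^ (n + 4) ≤
        999 / 1000 * ⟪D2w 0 e, e⟫ * (-w 0 - δ) ^ (n + 4) := by gcongr
    have h2 : 1001 / 1000 * m * u ^ (n + 4) * Real.exp (A / 2 * ‖x‖ ^ 2) ≤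
        1001 / 1000 * B * 3 := by
      rw [mul_assoc (1001 / 1000)]
      gcongr
    linarith
  rcases eq_or_ne a 0 with rfl | ha
  · simp
  have ha0 : ‖a‖ ≠ 0 := norm_ne_zero_iff.2 ha
  have h1 := key (‖a‖⁻¹ • a) (by rw [norm_smul, norm_inv, norm_norm, inv_mul_cancel₀ ha0])
  rw [map_smul, inner_smul_left, inner_smul_right, conj_trivial, ← mul_assoc] at h1
  calc ⟪D2w 0 a, a⟫ = (‖a‖⁻¹ * ‖a‖⁻¹ * ⟪D2w 0 a, a⟫) * ‖a‖ ^ 2 := by field_simp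
    _ ≤ _ := by gcongr

end IsMongeAmpereSolution

end Solutions

section Normalization

variable {E : Type*} [NormedAddCommGroup E] [NormedSpace ℝ E] {n : ℕ}

lemma Convex.smul_mem_of_mem_closure {Ω : Set E} (hc : Convex ℝ Ω) (ho : IsOpen Ω)
    (h0 : (0 : E) ∈ Ω) {y : E} (hy : y ∈ closure Ω) {c : ℝ} (hc0 : 0 ≤ c) (hc1 : c < 1) :
    c • y ∈ Ω := by
  have := hc.combo_interior_closure_mem_interior (x := 0) (by rwa [ho.interior_eq]) hy
    (sub_pos.2 hc1) hc0 (by ring)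
  rwa [smul_zero, zero_add, ho.interior_eq] at this

lemma exists_smul_mem_frontier {Ω : Set E} (ho : IsOpen Ω) (hb : Bornology.IsBounded Ω) {x : E}
    (hx : x ∈ Ω) (hx0 : x ≠ 0) : ∃ T : ℝ, 1 < T ∧ T • x ∈ frontier Ω := by
  have hcont : Continuous fun s : ℝ => s • x := by fun_prop
  have hS : IsCompact {s : ℝ | 1 ≤ s ∧ s • x ∈ closure Ω} := by
    refine Metric.isCompact_of_isClosed_isBounded
      (isClosed_Ici.inter (isClosed_closure.preimage hcont)) ?_
    obtain ⟨R, hR⟩ := hb.closure.exists_norm_le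
    refine isBounded_iff_forall_norm_le.2 ⟨R / ‖x‖, fun s hs => ?_⟩
    rw [le_div_iff₀ (norm_pos_iff.2 hx0), ← norm_smul]
    exact hR _ hs.2
  obtain ⟨T, ⟨hT1, hT⟩, hmax⟩ := hS.exists_isMaxOn ⟨1, le_rfl, by simpa using subset_closure hx⟩
    continuousOn_id
  have hTΩ : T • x ∉ Ω := fun hmem => by
    have hnhds : ∀ᶠ s in nhdsWithin T (Ioi T), s • x ∈ Ω :=
      nhdsWithin_le_nhds (hcont.continuousAt.eventually_mem (ho.mem_nhds hmem))
    obtain ⟨s, hs, hsT⟩ := (hnhds.and self_mem_nhdsWithin).exists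
    exact (hmax ⟨hT1.trans (le_of_lt hsT), subset_closure hs⟩).not_gt hsT
  refine ⟨T, lt_of_le_of_ne hT1 fun h => hTΩ ?_, ?_⟩
  · rwa [← h, one_smul]
  · rw [ho.frontier_eq]
    exact ⟨hT, hTΩ⟩

lemma IsBalancedPoint.neg_smul_mem {Ω : Set (EuclideanSpace ℝ (Fin n))} {b : ℝ} (hb1 : 1 ≤ b)
    (h : IsBalancedPoint Ω 0 b) (hc : Convex ℝ Ω) (ho : IsOpen Ω) (hb : Bornology.IsBounded Ω)
    (h0 : (0 : EuclideanSpace ℝ (Fin n)) ∈ Ω) {x : EuclideanSpace ℝ (Fin n)} (hx : x ∈ Ω) :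
    -(1 / b) • x ∈ Ω := by
  by_cases hx0 : x = 0
  · simpa [hx0] using h0
  obtain ⟨T, hT1, hT⟩ := exists_smul_mem_frontier ho hb hx hx0
  obtain ⟨t, ht1, -, ht⟩ := h _ hT
  have hb0 : 0 < b := by linarith
  have ht0 : 0 < t := lt_of_lt_of_le (by positivity) ht1
  have hbt : 1 ≤ t * b := by rwa [div_le_iff₀ hb0] at ht1
  have hbtT : 1 < b * t * T := by nlinarith
  have := hc.smul_mem_of_mem_closure ho h0 (frontier_subset_closure ht)
    (c := 1 / (b * t * T)) (by positivity) (by rwa [div_lt_one (by linarith)])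
  convert this using 1
  rw [sub_zero, zero_sub, smul_neg, smul_smul, smul_smul, ← neg_smul]
  congr 1
  have : T ≠ 0 := by positivity
  field_simp

lemma exists_auerbach {K : Set (EuclideanSpace ℝ (Fin n))} (hK : IsCompact K)
    (h0 : K ∈ nhds (0 : EuclideanSpace ℝ (Fin n))) :
    ∃ V : EuclideanSpace ℝ (Fin n) ≃L[ℝ] EuclideanSpace ℝ (Fin n),
      (∀ i, V (EuclideanSpace.single i 1) ∈ K) ∧ ∀ y, V y ∈ K → ∀ i, |y i| ≤ 1 := by
  set e := (EuclideanSpace.basisFun (Fin n) ℝ).toBasis with he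
  have hcont : Continuous fun v : Fin n → EuclideanSpace ℝ (Fin n) => |e.det v| := by
    refine continuous_abs.comp ?_
    have h1 : ⇑e.det = fun v => (e.toMatrix v).det := funext fun v => e.det_apply v
    rw [h1]
    refine Continuous.matrix_det ?_
    refine continuous_matrix fun i j => ?_
    simp only [Module.Basis.toMatrix_apply, he, OrthonormalBasis.coe_toBasis_repr_apply,
      EuclideanSpace.basisFun_repr]
    fun_prop
  obtain ⟨ε, hε, hεK⟩ := Metric.mem_nhds_iff.1 h0
  have hmem : (fun i => (ε / 2) • e i) ∈ univ.pi fun _ : Fin n => K := fun i _ => hεK (by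
    have : |ε| = ε := abs_of_pos hε
    simp [he, norm_smul, this, hε])
  obtain ⟨v, hv, hmax⟩ := (isCompact_univ_pi fun _ : Fin n => hK).exists_isMaxOn ⟨_, hmem⟩
    hcont.continuousOn
  have hdet : e.det v ≠ 0 := by
    have h1 := hmax hmem
    have h2 : e.det (fun i => (ε / 2) • e i) = (ε / 2) ^ n := by
      rw [e.det.map_smul_univ (fun _ => ε / 2) e]
      simp [Module.Basis.det_self, div_pow]
    simp only [mem_ofPred_eq, h2] at h1
    exact abs_pos.1 (lt_of_lt_of_le (by positivity) h1)
  obtain ⟨hli, hsp⟩ := e.is_basis_iff_det.2 hdet.isUnit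
  set B := Module.Basis.mk hli hsp.ge with hB
  have hBv : ∀ i, B i = v i := fun i => by simp [hB]
  set V := (e.equiv B (Equiv.refl _)).toContinuousLinearEquiv with hV
  have hVe : ∀ i, V (EuclideanSpace.single i 1) = v i := fun i => by
    have : e i = EuclideanSpace.single i 1 := by simp [he]
    rw [← this, hV, LinearEquiv.coe_toContinuousLinearEquiv', Module.Basis.equiv_apply]
    simp [hBv]
  refine ⟨V, fun i => by rw [hVe]; exact hv i (mem_univ i), fun y hy i => ?_⟩
  have hVy : V y = ∑ j, y j • v j := by
    conv_lhs => rw [← (EuclideanSpace.basisFun (Fin n) ℝ).sum_repr y]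
    simp [hVe]
  have hup : e.det (Function.update v i (V y)) = y i * e.det v := by
    rw [hVy, AlternatingMap.map_update_sum, Finset.sum_eq_single i]
    · rw [AlternatingMap.map_update_smul, Function.update_eq_self, smul_eq_mul]
    · intro j _ hj
      rw [AlternatingMap.map_update_smul, AlternatingMap.map_update_self _ _ hj.symm, smul_zero]
    · simp
  have hm : Function.update v i (V y) ∈ univ.pi fun _ : Fin n => K := fun j _ => by
    rcases eq_or_ne j i with rfl | hj
    · simpa using hy
    · simpa [hj] using hv j (mem_univ j)
  have h1 := hmax hm
  simp only [mem_ofPred_eq, hup, abs_mul] at h1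
  exact le_of_mul_le_mul_right (by simpa using h1) (abs_pos.2 hdet)

end Normalization

section Normalization

variable {n : ℕ}

lemma det_smul_adjoint_comp {E : Type*} [NormedAddCommGroup E] [InnerProductSpace ℝ E]
    [FiniteDimensional ℝ E] (V A : E →L[ℝ] E) (c : ℝ) :
    LinearMap.det ((c • (ContinuousLinearMap.adjoint V ∘L A ∘L V) : E →L[ℝ] E) : E →ₗ[ℝ] E) =
      c ^ Module.finrank ℝ E * LinearMap.det (V : E →ₗ[ℝ] E) ^ 2 *
        LinearMap.det (A : E →ₗ[ℝ] E) := by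
  have h1 : LinearMap.det (ContinuousLinearMap.adjoint V : E →ₗ[ℝ] E)
      = LinearMap.det (V : E →ₗ[ℝ] E) := by
    have h2 : (ContinuousLinearMap.adjoint V : E →ₗ[ℝ] E)
        = LinearMap.adjoint (V : E →ₗ[ℝ] E) := by
      rw [LinearMap.adjoint_eq_toCLM_adjoint]
      rfl
    set u := stdOrthonormalBasis ℝ E
    rw [h2, ← LinearMap.det_toMatrix u.toBasis, LinearMap.toMatrix_adjoint u u,
      Matrix.det_conjTranspose, LinearMap.det_toMatrix, star_trivial]
  rw [ContinuousLinearMap.toLinearMap_smul, LinearMap.det_smul]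
  change _ * LinearMap.det ((ContinuousLinearMap.adjoint V : E →ₗ[ℝ] E) ∘ₗ
    ((A : E →ₗ[ℝ] E) ∘ₗ (V : E →ₗ[ℝ] E))) = _
  rw [LinearMap.det_comp, LinearMap.det_comp, h1]
  ring

lemma IsMongeAmpereSolution.comp_equiv {E : Type*} [NormedAddCommGroup E] [InnerProductSpace ℝ E]
    [FiniteDimensional ℝ E] {Ω : Set E} {w : E → ℝ} {Dw : E → E} {D2w : E → (E →L[ℝ] E)}
    (h : IsMongeAmpereSolution Ω w Dw D2w) (V : E ≃L[ℝ] E) {c : ℝ} (hc : 0 ≤ c)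
    (hdet : c ^ Module.finrank ℝ E * LinearMap.det (V : E →ₗ[ℝ] E) ^ 2 = 1) :
    IsMongeAmpereSolution (V ⁻¹' Ω) (fun x => c * w (V x))
      (fun x => c • ContinuousLinearMap.adjoint (V : E →L[ℝ] E) (Dw (V x)))
      (fun x => c • (ContinuousLinearMap.adjoint (V : E →L[ℝ] E) ∘L D2w (V x) ∘L (V : E →L[ℝ] E)))
    where
  convex := h.convex.linear_preimage (V : E →ₗ[ℝ] E)
  isOpen := h.isOpen.preimage V.continuous
  isBounded := by
    rw [← V.image_symm_eq_preimage]
    exact h.isBounded.image (V.symm : E →L[ℝ] E)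
  continuousOn := by
    rw [← V.preimage_closure]
    exact (h.continuousOn.comp V.continuous.continuousOn fun x hx => hx).const_mul c
  convexOn := by
    rw [← V.preimage_closure]
    exact (h.convexOn.comp_linearMap (V : E →ₗ[ℝ] E)).smul hc
  hasGradientAt x hx := by
    rw [hasGradientAt_iff_hasFDerivAt]
    have h1 := (hasGradientAt_iff_hasFDerivAt.1 (h.hasGradientAt _ hx)).comp x V.hasFDerivAt
    refine (h1.const_mul c).congr_fderiv ?_
    ext a
    simp [ContinuousLinearMap.adjoint_inner_left]
  hasFDerivAt x hx := by
    have h1 := (h.hasFDerivAt _ hx).comp x V.hasFDerivAt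
    exact ((ContinuousLinearMap.adjoint (V : E →L[ℝ] E)).hasFDerivAt.comp x h1).const_smul c
  continuousOn_hess := by
    have h1 : ContinuousOn (fun x => D2w (V x)) (V ⁻¹' Ω) :=
      h.continuousOn_hess.comp V.continuous.continuousOn fun x hx => hx
    exact (continuousOn_const.clm_comp (h1.clm_comp continuousOn_const)).const_smul c
  det_eq_one x hx := by
    rw [det_smul_adjoint_comp, h.det_eq_one _ hx, mul_one]
    exact hdet
  eq_zero x hx := by
    have : V x ∈ frontier Ω := by
      have := V.toHomeomorph.preimage_frontier Ω
      change x ∈ V.toHomeomorph ⁻¹' frontier Ω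
      rw [this]; exact hx
    rw [h.eq_zero _ this, mul_zero]

lemma IsBalancedPoint.exists_normalization (hn : n ≠ 0) {Ω : Set (EuclideanSpace ℝ (Fin n))} {b : ℝ}
    (hb1 : 1 ≤ b) (h : IsBalancedPoint Ω 0 b) (hc : Convex ℝ Ω) (ho : IsOpen Ω)
    (hb : Bornology.IsBounded Ω) (h0 : (0 : EuclideanSpace ℝ (Fin n)) ∈ Ω) :
    ∃ V : EuclideanSpace ℝ (Fin n) ≃L[ℝ] EuclideanSpace ℝ (Fin n),
      ball 0 (1 / (n : ℝ)) ⊆ V ⁻¹' Ω ∧ V ⁻¹' Ω ⊆ ball 0 (b * n + 1) := by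
  have hn0 : (0 : ℝ) < n := by positivity
  have hb0 : 0 < b := by linarith
  obtain ⟨V, hV1, hV2⟩ := exists_auerbach (K := closure Ω ∩ -closure Ω)
    (hb.isCompact_closure.inter_right isClosed_closure.neg)
    (Filter.inter_mem (Filter.mem_of_superset (ho.mem_nhds h0) subset_closure)
      (neg_mem_nhds_zero _ (Filter.mem_of_superset (ho.mem_nhds h0) subset_closure)))
  have hsum : ∀ y, V y = ∑ i, y i • V (EuclideanSpace.single i 1) := fun y => by
    conv_lhs => rw [← (EuclideanSpace.basisFun (Fin n) ℝ).sum_repr y]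
    simp
  refine ⟨V, fun y hy => ?_, fun y hy => ?_⟩
  · rw [mem_ball_zero_iff] at hy
    have hyi : ∀ i, (n * y i) • V (EuclideanSpace.single i 1) ∈ Ω := fun i => by
      have h1 : |n * y i| < 1 := by
        have h2 : |y i| < 1 / n := by
          simpa using (PiLp.norm_apply_le y i).trans_lt hy
        rw [abs_mul, abs_of_pos hn0]
        rwa [lt_div_iff₀' hn0] at h2
      rcases le_total 0 (n * y i) with hs | hs
      · rw [abs_of_nonneg hs] at h1
        exact hc.smul_mem_of_mem_closure ho h0 (hV1 i).1 hs h1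
      · rw [abs_of_nonpos hs] at h1
        have := hc.smul_mem_of_mem_closure ho h0 (hV1 i).2 (neg_nonneg.2 hs) h1
        rwa [smul_neg, neg_smul, neg_neg] at this
    have := hc.sum_mem (t := Finset.univ) (w := fun _ => 1 / (n : ℝ)) (fun _ _ => by positivity)
      (by simp [hn0.ne']) fun i _ => hyi i
    rw [mem_preimage, hsum]
    convert this using 2 with i
    rw [smul_smul]
    congr 1
    field_simp
  · have hyi : ∀ i, |y i| ≤ b := fun i => by
      have h1 := hV2 ((1 / b) • y) (by
        rw [map_smul]
        refine ⟨subset_closure ?_, mem_neg.2 (subset_closure ?_)⟩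
        · rcases hb1.eq_or_lt with rfl | hb1
          · simpa using hy
          · exact hc.smul_mem_of_mem_closure ho h0 (subset_closure hy) (by positivity)
              (by rwa [div_lt_one hb0])
        · rw [← neg_smul]
          exact h.neg_smul_mem hb1 hc ho hb h0 hy) i
      rw [PiLp.smul_apply, smul_eq_mul, abs_mul, abs_of_pos (by positivity), one_div,
        inv_mul_le_iff₀ hb0, mul_one] at h1
      exact h1
    rw [mem_ball_zero_iff]
    have h2 : ‖y‖ ≤ ∑ i, |y i| := by
      conv_lhs => rw [← (EuclideanSpace.basisFun (Fin n) ℝ).sum_repr y]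
      refine (norm_sum_le _ _).trans (Finset.sum_le_sum fun i _ => ?_)
      simp [norm_smul]
    have h3 : ∑ i, |y i| ≤ n * b := by
      simpa using Finset.sum_le_sum (s := Finset.univ) fun i _ => hyi i
    linarith

end Normalization

section GoodShape

variable {n : ℕ}

lemma good_shape_of_norm_comparison {Ω : Set (EuclideanSpace ℝ (Fin n))}
    {V : EuclideanSpace ℝ (Fin n) ≃L[ℝ] EuclideanSpace ℝ (Fin n)} {r R c A B : ℝ} (hr : 0 < r)
    (hR : 0 < R) (hc : 0 < c) (hA : 0 < A) (hB : 0 < B) (h1 : ball 0 r ⊆ V ⁻¹' Ω)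
    (h2 : V ⁻¹' Ω ⊆ ball 0 R) (hVA : ∀ a, ‖a‖ ^ 2 ≤ A * (c * ‖V a‖ ^ 2))
    (hVB : ∀ a, c * ‖V a‖ ^ 2 ≤ B * ‖a‖ ^ 2) (hK : 1 ≤ √(B * A) * (R / r)) :
    ∃ (y₀ : EuclideanSpace ℝ (Fin n)) (r' R' : ℝ),
      0 < r' ∧ r' ≤ R' ∧ ball y₀ r' ⊆ Ω ∧ Ω ⊆ ball y₀ R' ∧ R' / r' ≤ √(B * A) * (R / r) := by
  have hAc : 0 < √(A * c) := Real.sqrt_pos.2 (by positivity)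
  have hAc2 : √(A * c) ^ 2 = A * c := Real.sq_sqrt (by positivity)
  have hBc : 0 < √(B / c) := Real.sqrt_pos.2 (by positivity)
  have hBc2 : √(B / c) ^ 2 = B / c := Real.sq_sqrt (by positivity)
  have hr' : 0 < r / √(A * c) := by positivity
  have hratio : √(B / c) * R / (r / √(A * c)) = √(B * A) * (R / r) := by
    have : √(B * A) = √(B / c) * √(A * c) := by
      rw [← Real.sqrt_mul (by positivity)]
      congr 1
      field_simp
    rw [this]
    field_simp
  refine ⟨0, r / √(A * c), √(B / c) * R, hr', ?_, fun x hx => ?_, fun x hx => ?_, hratio.le⟩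
  · rwa [← hratio, one_le_div hr'] at hK
  · have hx' : ‖V.symm x‖ < r := by
      rw [mem_ball_zero_iff, lt_div_iff₀ hAc] at hx
      refine lt_of_pow_lt_pow_left₀ 2 hr.le ?_
      have h3 := hVA (V.symm x)
      rw [V.apply_symm_apply] at h3
      have h4 : (‖x‖ * √(A * c)) ^ 2 < r ^ 2 := by gcongr
      rw [mul_pow, hAc2] at h4
      linarith
    simpa using h1 (mem_ball_zero_iff.2 hx')
  · have hx' : ‖V.symm x‖ < R := mem_ball_zero_iff.1 (h2 (by simpa using hx))
    rw [mem_ball_zero_iff]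
    refine lt_of_pow_lt_pow_left₀ 2 (by positivity) ?_
    have h3 := hVB (V.symm x)
    rw [V.apply_symm_apply] at h3
    have h4 : B * ‖V.symm x‖ ^ 2 < B * R ^ 2 := by gcongr
    rw [mul_pow, hBc2, div_mul_eq_mul_div, lt_div_iff₀ hc]
    linarith

lemma exists_pow_mul_sq_eq_one (hn : n ≠ 0) {d : ℝ} (hd : d ≠ 0) : ∃ c > 0, c ^ n * d ^ 2 = 1 := by
  have hd2 : 0 < d ^ 2 := by positivity
  refine ⟨((d ^ 2)⁻¹) ^ ((n : ℝ)⁻¹), by positivity, ?_⟩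
  rw [Real.rpow_inv_natCast_pow (by positivity) hn, inv_mul_cancel₀ hd2.ne']

end GoodShape

/-- Lemma 3.6: if `w` solves `det D²w = 1` in a bounded convex domain `Ω`, is constant on
`∂Ω`, `0` is a balanced point of `Ω` with constant `b`, and `‖D²w(0)‖ ≤ Λ₀`, then `Ω` has
a good shape with a constant `C` depending only on `n`, `b`, `Λ₀`. -/
theorem good_shape_of_balanced (n : ℕ) (b Λ₀ : ℝ) (hb : 1 ≤ b) (hΛ₀ : 0 < Λ₀) :
    ∃ C > (0:ℝ),
      ∀ (Ω : Set (EuclideanSpace ℝ (Fin n)))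
        (w : EuclideanSpace ℝ (Fin n) → ℝ)
        (Dw : EuclideanSpace ℝ (Fin n) → EuclideanSpace ℝ (Fin n))
        (D2w : EuclideanSpace ℝ (Fin n) →
          (EuclideanSpace ℝ (Fin n) →L[ℝ] EuclideanSpace ℝ (Fin n))),
        -- Ω is a bounded convex open domain containing 0
        Convex ℝ Ω → IsOpen Ω → Bornology.IsBounded Ω →
        (0 : EuclideanSpace ℝ (Fin n)) ∈ Ω →
        -- w ∈ C²(Ω) ∩ C(Ω̄) is convex
        ContinuousOn w (closure Ω) → ConvexOn ℝ (closure Ω) w →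
        (∀ x ∈ Ω, HasGradientAt w (Dw x) x) →
        (∀ x ∈ Ω, HasFDerivAt Dw (D2w x) x) →
        ContinuousOn D2w Ω →
        -- det D²w = 1 in Ω
        (∀ x ∈ Ω, LinearMap.det (D2w x : EuclideanSpace ℝ (Fin n) →ₗ[ℝ]
          EuclideanSpace ℝ (Fin n)) = 1) →
        -- w is constant on ∂Ω
        (∃ cst : ℝ, ∀ x ∈ frontier Ω, w x = cst) →
        -- 0 is a balanced point of Ω with constant b
        IsBalancedPoint Ω 0 b →
        -- the Hessian at 0 has operator norm at most Λ₀
        ‖D2w 0‖ ≤ Λ₀ →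
        -- conclusion: Ω has a good shape with constant C
        ∃ (y₀ : EuclideanSpace ℝ (Fin n)) (r R : ℝ),
          0 < r ∧ r ≤ R ∧ ball y₀ r ⊆ Ω ∧ Ω ⊆ ball y₀ R ∧ R / r ≤ C := by
  rcases eq_or_ne n 0 with rfl | hn
  · refine ⟨1, one_pos, fun Ω w Dw D2w _ _ _ h0 _ _ _ _ _ _ _ _ _ => ?_⟩
    refine ⟨0, 1, 1, one_pos, le_rfl, fun x _ => ?_, fun x _ => ?_, by norm_num⟩
    · rwa [Subsingleton.elim x 0]
    · rw [Subsingleton.elim x 0]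
      exact mem_ball_self one_pos
  have hb0 : 0 < b := by linarith
  have hn0 : (0 : ℝ) < n := by positivity
  have hn1 : (1 : ℝ) ≤ n := by exact_mod_cast Nat.one_le_iff_ne_zero.2 hn
  have : Nonempty (Fin n) := ⟨⟨0, Nat.pos_of_ne_zero hn⟩⟩
  have hdim : Module.finrank ℝ (EuclideanSpace ℝ (Fin n)) = n := by simp
  obtain ⟨C, hC, hbound⟩ := IsMongeAmpereSolution.exists_hess_bound n (r := 1 / (n : ℝ))
    (R := b * n + 1) (by positivity) (by positivity)
  set D := C ^ (n - 1) * Λ₀ with hD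
  have hD0 : 0 < D := by positivity
  refine ⟨√(D ^ (n - 1) * D) * ((b * n + 1) / (1 / (n : ℝ))), by positivity, ?_⟩
  rintro Ω w Dw D2w hconv hopen hbdd h0 hwc hwconv hDw hD2w hD2c hdet ⟨cst, hcst⟩ hbal hΛ
  obtain ⟨V, hV1, hV2⟩ := hbal.exists_normalization hn hb hconv hopen hbdd h0
  obtain ⟨c, hc, hcdet⟩ := exists_pow_mul_sq_eq_one hn
    (LinearEquiv.isUnit_det' V.toLinearEquiv).ne_zero
  have hsol : IsMongeAmpereSolution Ω (fun x => w x - cst) Dw D2w :=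
    { convex := hconv
      isOpen := hopen
      isBounded := hbdd
      continuousOn := hwc.sub continuousOn_const
      convexOn := by
        have := hwconv.add_const (-cst)
        exact this.congr fun x _ => (sub_eq_add_neg _ _).symm
      hasGradientAt := fun x hx => by
        have := hasGradientAt_iff_hasFDerivAt.1 (hDw x hx)
        exact hasGradientAt_iff_hasFDerivAt.2 (this.sub_const cst)
      hasFDerivAt := hD2w
      continuousOn_hess := hD2c
      det_eq_one := hdet
      eq_zero := fun x hx => by rw [hcst x hx, sub_self] }
  have hnorm := hsol.comp_equiv V hc.le (by rw [hdim]; exact hcdet)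
  have h0' : (0 : EuclideanSpace ℝ (Fin n)) ∈ V ⁻¹' Ω := by simpa using h0
  have hVA : ∀ a, ‖a‖ ^ 2 ≤ D * (c * ‖V a‖ ^ 2) := fun a => by
    have h1 := hnorm.norm_sq_le hdim h0' (hbound hdim hnorm hV1 hV2) a
    have h2 := (IsMongeAmpereSolution.inner_apply_le_norm_mul (D2w 0) (V a)).trans
      (mul_le_mul_of_nonneg_right hΛ (sq_nonneg _))
    have h3 : ⟪(c • (ContinuousLinearMap.adjoint (V : EuclideanSpace ℝ (Fin n) →L[ℝ] _) ∘L
        D2w (V 0) ∘L (V : EuclideanSpace ℝ (Fin n) →L[ℝ] _))) a, a⟫ = c * ⟪D2w 0 (V a), V a⟫ := by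
      simp [inner_smul_left, ContinuousLinearMap.adjoint_inner_left]
    rw [h3] at h1
    calc ‖a‖ ^ 2 ≤ C ^ (n - 1) * (c * ⟪D2w 0 (V a), V a⟫) := h1
      _ ≤ C ^ (n - 1) * (c * (Λ₀ * ‖V a‖ ^ 2)) := by gcongr
      _ = D * (c * ‖V a‖ ^ 2) := by rw [hD]; ring
  have hVB : ∀ a, c * ‖V a‖ ^ 2 ≤ D ^ (n - 1) * ‖a‖ ^ 2 := fun a => by
    set T : EuclideanSpace ℝ (Fin n) →L[ℝ] EuclideanSpace ℝ (Fin n) :=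
      c • (ContinuousLinearMap.adjoint (V : EuclideanSpace ℝ (Fin n) →L[ℝ] EuclideanSpace ℝ (Fin n)) ∘L
        ContinuousLinearMap.id ℝ (EuclideanSpace ℝ (Fin n)) ∘L
        (V : EuclideanSpace ℝ (Fin n) →L[ℝ] EuclideanSpace ℝ (Fin n))) with hT
    have hTinner : ∀ x y, ⟪T x, y⟫ = c * ⟪V x, V y⟫ := fun x y => by
      simp [hT, inner_smul_left, ContinuousLinearMap.adjoint_inner_left]
    have hTsymm : (T : EuclideanSpace ℝ (Fin n) →ₗ[ℝ] EuclideanSpace ℝ (Fin n)).IsSymmetric :=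
      fun x y => by
        change ⟪T x, y⟫ = ⟪x, T y⟫
        rw [real_inner_comm (T y) x, hTinner, hTinner, real_inner_comm]
    have hTdet : LinearMap.det (T : EuclideanSpace ℝ (Fin n) →ₗ[ℝ] _) = 1 := by
      rw [hT, det_smul_adjoint_comp, hdim]
      simpa using hcdet
    have hTa : ∀ x, ⟪T x, x⟫ = c * ‖V x‖ ^ 2 := fun x => by
      rw [hTinner, real_inner_self_eq_norm_sq]
    have h1 := le_norm_sq_of_det_eq_one hTsymm hdim hTdet (s := D⁻¹) (by positivity)
      (fun x => by
        change D⁻¹ * ‖x‖ ^ 2 ≤ ⟪T x, x⟫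
        rw [hTa, inv_mul_le_iff₀ hD0]
        exact hVA x) a
    change (D⁻¹) ^ (n - 1) * ⟪T a, a⟫ ≤ _ at h1
    rwa [hTa, inv_pow, inv_mul_le_iff₀ (by positivity)] at h1
  refine good_shape_of_norm_comparison (by positivity) (by positivity) hc hD0 (by positivity)
    hV1 hV2 hVA hVB (one_le_mul_of_one_le_of_one_le ?_ ?_)
  · obtain ⟨a, ha⟩ := exists_ne (0 : EuclideanSpace ℝ (Fin n))
    have ha2 : 0 < ‖V a‖ ^ 2 := by
      have : V a ≠ 0 := by simpa using ha
      positivity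
    have h1 : c * ‖V a‖ ^ 2 ≤ D ^ (n - 1) * (D * (c * ‖V a‖ ^ 2)) :=
      (hVB a).trans (by gcongr; exact hVA a)
    rw [Real.one_le_sqrt]
    refine le_of_mul_le_mul_right ?_ (mul_pos hc ha2)
    linarith
  · rw [one_le_div (by positivity), div_le_iff₀ hn0]
    nlinarith [mul_nonneg hb0.le (sq_nonneg (n : ℝ))]
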